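/- The deformed Noumi–Sano operators preserve the algebra Λ_{n,m;q,t} (instance of the preservation lemma): Let n, m ∈ ℕ, r ∈ ℕ, and let q, t ∈ ℂ∖{0} be such that neither q nor t is a root of unity. Let p ∈ ℂ[x_1,…,x_n,y_1,…,y_m] belong to Λ_{n,m;q,t}. Then there exists a polynomial P ∈ Λ_{n,m;q,t} such that (ℋ^r_{n,m} p)(x,y) = P(x,y) for every (x,y) ∈ ℂ^n × ℂ^m at which all coefficient functions B_{μ,I} occurring in the finite sum defining ℋ^r_{n,m} have nonzero denominators. -/

import Mathlib

open Finset

noncomputable section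

/-- Finite `q`-Pochhammer symbol `(a;q)_k = ∏_{i=0}^{k-1} (1 - a q^i)`. -/
def qPoch (a q : ℂ) (k : ℕ) : ℂ := ∏ i ∈ Finset.range k, (1 - a * q ^ i)

/-- Infinite `q`-Pochhammer symbol `(a;q)_∞ = ∏_{i=0}^{∞} (1 - a q^i)`. -/
def qPochInf (a q : ℂ) : ℂ := ∏' i : ℕ, (1 - a * q ^ i)

/-- Vandermonde-type product `Δ(x) = ∏_{i<j} (x_i - x_j)`. -/
def vand {n : ℕ} (x : Fin n → ℂ) : ℂ := ∏ i : Fin n, ∏ j ∈ Finset.Ioi i, (x i - x j)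

/-- The shift `x_i ↦ q^{μ_i} x_i`. -/
def qShift {n : ℕ} (q : ℂ) (μ : Fin n → ℕ) (x : Fin n → ℂ) : Fin n → ℂ :=
  fun i => q ^ μ i * x i

/-- The shift `y_j ↦ t^{-1} y_j` for `j ∈ I`. -/
def tShiftI {m : ℕ} (t : ℂ) (I : Finset (Fin m)) (y : Fin m → ℂ) : Fin m → ℂ :=
  fun j => if j ∈ I then t⁻¹ * y j else y j

/-- The shift `x_i ↦ q x_i` for `i ∈ I`. -/
def qShiftI {n : ℕ} (q : ℂ) (I : Finset (Fin n)) (x : Fin n → ℂ) : Fin n → ℂ :=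
  fun i => if i ∈ I then q * x i else x i

/-- The shift `y_j ↦ t^{-μ_j} y_j`. -/
def tShift {m : ℕ} (t : ℂ) (μ : Fin m → ℕ) (y : Fin m → ℂ) : Fin m → ℂ :=
  fun j => t ^ (-(μ j : ℤ)) * y j

/-- Coefficient functions `B_{μ,I}(x,y;q,t)` of the deformed Noumi–Sano operators. -/
def Bcoef (n m : ℕ) (q t : ℂ) (μ : Fin n → ℕ) (I : Finset (Fin m))
    (x : Fin n → ℂ) (y : Fin m → ℂ) : ℂ :=
  vand (qShift q μ x) / vand x
    * (∏ i : Fin n, ∏ j : Fin n, qPoch (t * x i / x j) q (μ i) / qPoch (q * x i / x j) q (μ i))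
    * (∏ i ∈ I, ∏ j ∈ Iᶜ, (y i - q * y j) / (y i - y j))
    * ∏ i : Fin n, ((∏ j ∈ I, (1 - x i / (t * y j)) / (1 - q ^ μ i * x i / y j))
        * ∏ j ∈ Iᶜ, (1 - x i / (q * y j)) / (1 - q ^ ((μ i : ℤ) - 1) * x i / y j))

/-- Product of all the factors occurring in a denominator of `B_{μ,I}(x,y;q,t)`. -/
def BcoefDen (n m : ℕ) (q t : ℂ) (μ : Fin n → ℕ) (I : Finset (Fin m))
    (x : Fin n → ℂ) (y : Fin m → ℂ) : ℂ :=
  q * t * vand x * (∏ i : Fin n, x i) * (∏ j : Fin m, y j)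
    * (∏ i : Fin n, ∏ j : Fin n, qPoch (q * x i / x j) q (μ i))
    * (∏ i ∈ I, ∏ j ∈ Iᶜ, (y i - y j))
    * ∏ i : Fin n, ((∏ j ∈ I, (1 - q ^ μ i * x i / y j))
        * ∏ j ∈ Iᶜ, (1 - q ^ ((μ i : ℤ) - 1) * x i / y j))

/-- Taylor coefficients `c_k` of `(t^{1-n} q^m u;q)_∞ / (t u;q)_∞`. -/
def cH (n m : ℕ) (q t : ℂ) (k : ℕ) : ℂ :=
  ∑ j ∈ Finset.range (k + 1),
    (-(t ^ ((1 : ℤ) - (n : ℤ)) * q ^ m)) ^ j * q ^ (j * (j - 1) / 2) * t ^ (k - j)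
      / (qPoch q q j * qPoch q q (k - j))

/-- The deformed Noumi–Sano operator `ℋ^r_{n,m}(x,y;q,t)` applied to `f` at `(x,y)`. -/
def Hop (n m : ℕ) (q t : ℂ) (r : ℕ)
    (f : (Fin n → ℂ) → (Fin m → ℂ) → ℂ) (x : Fin n → ℂ) (y : Fin m → ℂ) : ℂ :=
  ∑ k ∈ Finset.range (r + 1),
    ∑ μ ∈ Fintype.piFinset (fun _ : Fin n => Finset.range (r + 1)),
      ∑ I : Finset (Fin m),
        if k + (∑ i, μ i) + I.card = r then
          cH n m q t k * (t ^ ((1 : ℤ) - (n : ℤ)) * q ^ m) ^ (∑ i, μ i)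
            * (-t) ^ I.card * q ^ (I.card * (I.card - 1) / 2)
            * Bcoef n m q t μ I x y * f (qShift q μ x) (tShiftI t I y)
        else 0

/-- Coefficient functions `A_{I,μ}(x,y;q,t)` of the deformed Macdonald–Ruijsenaars operators. -/
def Acoef (n m : ℕ) (q t : ℂ) (I : Finset (Fin n)) (μ : Fin m → ℕ)
    (x : Fin n → ℂ) (y : Fin m → ℂ) : ℂ :=
  (∏ i ∈ I, ∏ j ∈ Iᶜ, (x i - t⁻¹ * x j) / (x i - x j))
    * (vand (tShift t μ y) / vand y)
    * (∏ i : Fin m, ∏ j : Fin m, qPoch (y i / (q * y j)) t⁻¹ (μ i) / qPoch (y i / (t * y j)) t⁻¹ (μ i))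
    * ∏ i : Fin m, ((∏ j ∈ I, (1 - q * y i / x j) / (1 - t ^ (-(μ i : ℤ)) * y i / x j))
        * ∏ j ∈ Iᶜ, (1 - t * y i / x j) / (1 - t ^ (1 - (μ i : ℤ)) * y i / x j))

/-- Product of all the factors occurring in a denominator of `A_{I,μ}(x,y;q,t)`. -/
def AcoefDen (n m : ℕ) (q t : ℂ) (I : Finset (Fin n)) (μ : Fin m → ℕ)
    (x : Fin n → ℂ) (y : Fin m → ℂ) : ℂ :=
  q * t * vand y * (∏ i : Fin n, x i) * (∏ j : Fin m, y j)
    * (∏ i ∈ I, ∏ j ∈ Iᶜ, (x i - x j))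
    * (∏ i : Fin m, ∏ j : Fin m, qPoch (y i / (t * y j)) t⁻¹ (μ i))
    * ∏ i : Fin m, ((∏ j ∈ I, (1 - t ^ (-(μ i : ℤ)) * y i / x j))
        * ∏ j ∈ Iᶜ, (1 - t ^ (1 - (μ i : ℤ)) * y i / x j))

/-- Taylor coefficients `d_k` of `(q^m t^{-n} u;t^{-1})_∞ / (u;t^{-1})_∞`. -/
def dD (n m : ℕ) (q t : ℂ) (k : ℕ) : ℂ :=
  ∑ j ∈ Finset.range (k + 1),
    (-(q ^ m * t ^ (-(n : ℤ)))) ^ j * t⁻¹ ^ (j * (j - 1) / 2)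
      / (qPoch t⁻¹ t⁻¹ j * qPoch t⁻¹ t⁻¹ (k - j))

/-- The deformed Macdonald–Ruijsenaars operator `𝒟^r_{n,m}(x,y;q,t)` applied to `f` at `(x,y)`. -/
def Dop (n m : ℕ) (q t : ℂ) (r : ℕ)
    (f : (Fin n → ℂ) → (Fin m → ℂ) → ℂ) (x : Fin n → ℂ) (y : Fin m → ℂ) : ℂ :=
  (-1 : ℂ) ^ r *
    ∑ k ∈ Finset.range (r + 1),
      ∑ I : Finset (Fin n),
        ∑ μ ∈ Fintype.piFinset (fun _ : Fin m => Finset.range (r + 1)),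
          if k + I.card + (∑ j, μ j) = r then
            dD n m q t k * (q ^ m * t ^ (-(n : ℤ))) ^ (∑ j, μ j)
              * (-1 : ℂ) ^ I.card * t⁻¹ ^ (I.card * (I.card - 1) / 2)
              * Acoef n m q t I μ x y * f (qShiftI q I x) (tShift t μ y)
          else 0

/-- Evaluation of a polynomial in the `n + m` variables `x_1,…,x_n,y_1,…,y_m` at the
point `(x,y)`. -/
def evalXY {n m : ℕ} (p : MvPolynomial (Fin n ⊕ Fin m) ℂ)
    (x : Fin n → ℂ) (y : Fin m → ℂ) : ℂ :=
  MvPolynomial.eval (Sum.elim x y) p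

/-- The algebra `Λ_{n,m;q,t}`: polynomials in `x = (x_1,…,x_n)` and `y = (y_1,…,y_m)`
that are symmetric in the `x` variables and in the `y` variables separately, and satisfy
`(T_{q,x_i} - T_{t,y_j}^{-1}) p = 0` along `x_i = y_j` for all `i, j`. -/
def memLambda (n m : ℕ) (q t : ℂ) (p : MvPolynomial (Fin n ⊕ Fin m) ℂ) : Prop :=
  (∀ (σ : Equiv.Perm (Fin n)) (τ : Equiv.Perm (Fin m)) (x : Fin n → ℂ) (y : Fin m → ℂ),
      evalXY p (x ∘ σ) (y ∘ τ) = evalXY p x y)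
  ∧ ∀ (i : Fin n) (j : Fin m) (x : Fin n → ℂ) (y : Fin m → ℂ), x i = y j →
      evalXY p (Function.update x i (q * x i)) y
        = evalXY p x (Function.update y j (t⁻¹ * y j))

section Zariski

open Filter Topology

variable {W : Type*}

/-- The filter of subsets of `W → ℂ` containing the complement of a hypersurface. -/
def zariski (W : Type*) : Filter (W → ℂ) where
  sets := {s | ∃ G : MvPolynomial W ℂ, G ≠ 0 ∧ ∀ v, MvPolynomial.eval v G ≠ 0 → v ∈ s}
  univ_sets := ⟨1, one_ne_zero, fun _ _ => trivial⟩
  sets_of_superset := by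
    rintro s t ⟨G, hG, h⟩ hst
    exact ⟨G, hG, fun v hv => hst (h v hv)⟩
  inter_sets := by
    rintro s t ⟨G, hG, h⟩ ⟨G', hG', h'⟩
    refine ⟨G * G', mul_ne_zero hG hG', fun v hv => ?_⟩
    rw [map_mul] at hv
    exact ⟨h v (left_ne_zero_of_mul hv), h' v (right_ne_zero_of_mul hv)⟩

theorem eventually_zariski {S : (W → ℂ) → Prop} :
    (∀ᶠ v in zariski W, S v) ↔
      ∃ G : MvPolynomial W ℂ, G ≠ 0 ∧ ∀ v, MvPolynomial.eval v G ≠ 0 → S v :=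
  Iff.rfl

theorem eventually_eval_ne_zero {G : MvPolynomial W ℂ} (hG : G ≠ 0) :
    ∀ᶠ v in zariski W, MvPolynomial.eval v G ≠ 0 :=
  eventually_zariski.2 ⟨G, hG, fun _ h => h⟩

theorem eq_of_eventually_eval_eq {P Q : MvPolynomial W ℂ}
    (h : ∀ᶠ v in zariski W, MvPolynomial.eval v P = MvPolynomial.eval v Q) : P = Q := by
  obtain ⟨G, hG, h⟩ := eventually_zariski.1 h
  have : (P - Q) * G = 0 := by
    refine MvPolynomial.funext fun v => ?_
    by_cases hv : MvPolynomial.eval v G = 0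
    · simp [hv]
    · simp [h v hv]
  exact sub_eq_zero.1 ((mul_eq_zero.1 this).resolve_right hG)

theorem eventually_eval_curve_ne_zero (G : MvPolynomial W ℂ) (γ : W → Polynomial ℂ) (e : ℂ)
    (he : MvPolynomial.eval (fun i => (γ i).eval e) G ≠ 0) (c : ℂ) :
    ∀ᶠ x in 𝓝[≠] c, MvPolynomial.eval (fun i => (γ i).eval x) G ≠ 0 := by
  have key : ∀ x : ℂ, (MvPolynomial.aeval γ G).eval x
      = MvPolynomial.eval (fun i => (γ i).eval x) G := by
    intro x
    rw [← Polynomial.coe_evalRingHom, MvPolynomial.aeval_def, MvPolynomial.hom_eval₂,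
      MvPolynomial.eval, MvPolynomial.coe_eval₂Hom]
    congr 1
    ext a
    simp
  have hne : MvPolynomial.aeval γ G ≠ 0 := by
    intro h
    apply he
    rw [← key, h, Polynomial.eval_zero]
  have hfin : ({x : ℂ | (MvPolynomial.aeval γ G).IsRoot x} \ {c}).Finite :=
    (Polynomial.finite_setOfPred_isRoot hne).subset Set.sdiff_subset
  have hfin' := hfin.isClosed.isOpen_compl.mem_nhds (x := c) (by simp)
  filter_upwards [mem_nhdsWithin_of_mem_nhds hfin', self_mem_nhdsWithin] with x hx hxc
  rw [← key]
  intro h0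
  exact hx ⟨h0, hxc⟩

theorem eventually_eventually_update [DecidableEq W] {S : (W → ℂ) → Prop}
    (h : ∀ᶠ v in zariski W, S v) :
    ∀ᶠ v in zariski W, ∀ (w : W) (c : ℂ), ∀ᶠ x in 𝓝[≠] c, S (Function.update v w x) := by
  obtain ⟨G, hG, h⟩ := eventually_zariski.1 h
  filter_upwards [eventually_eval_ne_zero hG] with v hv w c
  have hγ : ∀ x : ℂ, (fun i => (Function.update (fun i => Polynomial.C (v i)) w Polynomial.X
      i).eval x) = Function.update v w x := by
    intro x
    funext i
    by_cases hi : i = w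
    · subst hi
      simp
    · simp [hi]
  have := eventually_eval_curve_ne_zero G
    (Function.update (fun i => Polynomial.C (v i)) w Polynomial.X) (v w)
    (by rw [hγ, Function.update_eq_self]; exact hv) c
  filter_upwards [this] with x hx
  rw [hγ] at hx
  exact h _ hx

theorem frequently_nhds_of_eventually_zariski {S : (W → ℂ) → Prop}
    (h : ∀ᶠ v in zariski W, S v) (v₀ : W → ℂ) : ∃ᶠ v in 𝓝 v₀, S v := by
  obtain ⟨G, hG, h⟩ := eventually_zariski.1 h
  obtain ⟨v₁, hv₁⟩ : ∃ v, MvPolynomial.eval v G ≠ 0 := by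
    by_contra! hall
    exact hG (MvPolynomial.funext fun v => by simp [hall v])
  have := eventually_eval_curve_ne_zero G
    (fun i => Polynomial.C (v₀ i) + Polynomial.X * Polynomial.C (v₁ i - v₀ i)) 1
    (by simpa using hv₁) 0
  have hlim : Tendsto (fun x : ℂ => fun i => (Polynomial.C (v₀ i)
      + Polynomial.X * Polynomial.C (v₁ i - v₀ i)).eval x) (𝓝[≠] 0) (𝓝 v₀) := by
    have hc : Continuous (fun x : ℂ => fun i => (Polynomial.C (v₀ i)
      + Polynomial.X * Polynomial.C (v₁ i - v₀ i)).eval x) := by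
      refine continuous_pi fun i => Polynomial.continuous _
    have := (hc.tendsto 0).mono_left (nhdsWithin_le_nhds (s := {0}ᶜ))
    simpa using this
  refine hlim.frequently (Eventually.frequently ?_)
  filter_upwards [this] with x hx
  exact h _ hx

theorem eval_eq_of_eventually_zariski {P : MvPolynomial W ℂ} {f : (W → ℂ) → ℂ}
    (h : ∀ᶠ v in zariski W, MvPolynomial.eval v P = f v) {v₀ : W → ℂ} (hf : ContinuousAt f v₀) :
    MvPolynomial.eval v₀ P = f v₀ := by
  have hP : ContinuousAt (fun v : W → ℂ => MvPolynomial.eval v P) v₀ :=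
    (MvPolynomial.continuous_eval P).continuousAt
  by_contra hne
  exact frequently_nhds_of_eventually_zariski h v₀ ((hP.ne_iff_eventually_ne hf).1 hne)

theorem eventually_mul_ne_mul {u w : W} (huw : u ≠ w) {α : ℂ} (hα : α ≠ 0) (β : ℂ) :
    ∀ᶠ v in zariski W, α * v w ≠ β * v u := by
  classical
  have hG : (MvPolynomial.C α * MvPolynomial.X w - MvPolynomial.C β * MvPolynomial.X u :
      MvPolynomial W ℂ) ≠ 0 := by
    intro h
    have := congrArg (MvPolynomial.eval (Pi.single w 1)) h
    simp [huw, hα] at this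
  filter_upwards [eventually_eval_ne_zero hG] with v hv h
  apply hv
  simp [h]

theorem eventually_coord_ne (u : W) (c : ℂ) : ∀ᶠ v in zariski W, v u ≠ c := by
  have hG : (MvPolynomial.X u - MvPolynomial.C c : MvPolynomial W ℂ) ≠ 0 := by
    intro h
    have := congrArg (MvPolynomial.eval (fun _ => c + 1)) h
    simp at this
  filter_upwards [eventually_eval_ne_zero hG] with v hv h
  apply hv
  simp [h]

/-- The linear form `X_w - c X_u` attached to the triple `(w, u, c)`. -/
def linForm (k : W × W × ℂ) : MvPolynomial W ℂ :=
  MvPolynomial.X k.1 - MvPolynomial.C k.2.2 * MvPolynomial.X k.2.1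

theorem linForm_dvd [DecidableEq W] {k : W × W × ℂ} {N : MvPolynomial W ℂ}
    (h : ∀ᶠ v in zariski W,
      MvPolynomial.eval (Function.update v k.1 (k.2.2 * v k.2.1)) N = 0) :
    linForm k ∣ N := by
  obtain ⟨w, u, c⟩ := k
  set g : W → MvPolynomial W ℂ :=
    Function.update MvPolynomial.X w (MvPolynomial.C c * MvPolynomial.X u) with hg
  have hsub : MvPolynomial.bind₁ g N = 0 := by
    apply eq_of_eventually_eval_eq
    filter_upwards [h] with v hv
    rw [map_zero, ← hv]
    rw [← MvPolynomial.coe_aeval_eq_eval, RingHom.coe_coe, MvPolynomial.aeval_bind₁,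
      ← MvPolynomial.coe_aeval_eq_eval, RingHom.coe_coe]
    congr 2
    funext i
    by_cases hi : i = w
    · subst hi
      simp [hg]
    · simp [hg, hi]
  have hall : ∀ M : MvPolynomial W ℂ, linForm (w, u, c) ∣ M - MvPolynomial.bind₁ g M := by
    intro M
    induction M using MvPolynomial.induction_on with
    | C a => simp
    | add p r hp hr =>
      rw [map_add, add_sub_add_comm]
      exact dvd_add hp hr
    | mul_X p i hp =>
      have hi : linForm (w, u, c) ∣ MvPolynomial.X i - g i := by
        by_cases hi : i = w
        · subst hi
          simp [hg, linForm]
        · simp [hg, hi]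
      have : p * MvPolynomial.X i - MvPolynomial.bind₁ g (p * MvPolynomial.X i)
          = (p - MvPolynomial.bind₁ g p) * MvPolynomial.X i
            + MvPolynomial.bind₁ g p * (MvPolynomial.X i - g i) := by
        rw [map_mul, MvPolynomial.bind₁_X_right]
        ring
      rw [this]
      exact dvd_add (hp.mul_right _) (hi.mul_left _)
  simpa [hsub] using hall N

/-- `h` is generically a quotient of polynomials, with denominator a product of the linear
forms attached to `K`. -/
def HasLinearDenominators (K : Set (W × W × ℂ)) (h : (W → ℂ) → ℂ) : Prop :=
  ∃ L : List (W × W × ℂ), (∀ k ∈ L, k ∈ K) ∧ ∃ N : MvPolynomial W ℂ,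
    ∀ᶠ v in zariski W,
      MvPolynomial.eval v N = MvPolynomial.eval v (L.map linForm).prod * h v

namespace HasLinearDenominators

variable {K : Set (W × W × ℂ)} {f g : (W → ℂ) → ℂ}

theorem of_eval (N : MvPolynomial W ℂ) (h : ∀ᶠ v in zariski W, f v = MvPolynomial.eval v N) :
    HasLinearDenominators K f :=
  ⟨[], by simp, N, by filter_upwards [h] with v hv; simp [hv]⟩

theorem congr (hf : HasLinearDenominators K f) (h : ∀ᶠ v in zariski W, g v = f v) :
    HasLinearDenominators K g := by
  obtain ⟨L, hL, N, hN⟩ := hf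
  exact ⟨L, hL, N, by filter_upwards [hN, h] with v h1 h2; rw [h1, h2]⟩

theorem mul (hf : HasLinearDenominators K f) (hg : HasLinearDenominators K g) :
    HasLinearDenominators K (fun v => f v * g v) := by
  obtain ⟨L, hL, N, hN⟩ := hf
  obtain ⟨L', hL', N', hN'⟩ := hg
  refine ⟨L ++ L', List.forall_mem_append.2 ⟨hL, hL'⟩, N * N', ?_⟩
  filter_upwards [hN, hN'] with v h1 h2
  rw [map_mul, h1, h2, List.map_append, List.prod_append, map_mul]
  ring

theorem add (hf : HasLinearDenominators K f) (hg : HasLinearDenominators K g) :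
    HasLinearDenominators K (fun v => f v + g v) := by
  obtain ⟨L, hL, N, hN⟩ := hf
  obtain ⟨L', hL', N', hN'⟩ := hg
  refine ⟨L ++ L', List.forall_mem_append.2 ⟨hL, hL'⟩,
    N * (L'.map linForm).prod + N' * (L.map linForm).prod, ?_⟩
  filter_upwards [hN, hN'] with v h1 h2
  rw [map_add, map_mul, map_mul, h1, h2, List.map_append, List.prod_append, map_mul]
  ring

theorem prod {ι : Type*} (s : Finset ι) (f : ι → (W → ℂ) → ℂ)
    (h : ∀ i ∈ s, HasLinearDenominators K (f i)) :
    HasLinearDenominators K (fun v => ∏ i ∈ s, f i v) := by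
  classical
  induction s using Finset.induction_on with
  | empty => exact of_eval 1 (by simp)
  | insert a s ha ih =>
    simp only [Finset.prod_insert ha]
    exact (h a (by simp)).mul (ih fun i hi => h i (by simp [hi]))

theorem sum {ι : Type*} (s : Finset ι) (f : ι → (W → ℂ) → ℂ)
    (h : ∀ i ∈ s, HasLinearDenominators K (f i)) :
    HasLinearDenominators K (fun v => ∑ i ∈ s, f i v) := by
  classical
  induction s using Finset.induction_on with
  | empty => exact of_eval 0 (by simp)
  | insert a s ha ih =>
    simp only [Finset.sum_insert ha]
    exact (h a (by simp)).add (ih fun i hi => h i (by simp [hi]))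

theorem inv_form {w u : W} {c : ℂ} (hk : (w, u, c) ∈ K) (hwu : u ≠ w) :
    HasLinearDenominators K (fun v => (v w - c * v u)⁻¹) := by
  refine ⟨[(w, u, c)], by simpa using hk, 1, ?_⟩
  filter_upwards [eventually_mul_ne_mul hwu one_ne_zero c] with v hv
  have : v w - c * v u ≠ 0 := by
    rw [one_mul] at hv
    exact sub_ne_zero.2 hv
  simp [linForm, this]

theorem exists_eval_eq [DecidableEq W] (hf : HasLinearDenominators K f)
    (hK : ∀ k ∈ K, k.2.1 ≠ k.1 ∧ ∀ᶠ v in zariski W,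
      Tendsto (fun x : ℂ => x * f (Function.update v k.1 (k.2.2 * v k.2.1 + x)))
        (𝓝[≠] 0) (𝓝 0)) :
    ∃ P : MvPolynomial W ℂ, ∀ᶠ v in zariski W, MvPolynomial.eval v P = f v := by
  obtain ⟨L, hL, N, hN⟩ := hf
  induction L generalizing N with
  | nil => exact ⟨N, by simpa using hN⟩
  | cons k L ih =>
    obtain ⟨hne, hlim⟩ := hK k (hL k (by simp))
    have hdvd : linForm k ∣ N := by
      apply linForm_dvd
      filter_upwards [hlim, eventually_eventually_update hN] with v hv hupd
      have hshift : Tendsto (fun x : ℂ => k.2.2 * v k.2.1 + x) (𝓝[≠] 0)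
          (𝓝[≠] (k.2.2 * v k.2.1)) := by
        refine tendsto_nhdsWithin_iff.2 ⟨?_, ?_⟩
        · have : Continuous (fun x : ℂ => k.2.2 * v k.2.1 + x) := by fun_prop
          simpa using (this.tendsto 0).mono_left (nhdsWithin_le_nhds (s := {0}ᶜ))
        · filter_upwards [self_mem_nhdsWithin] with x hx
          simpa using hx
      have hcont : ∀ M : MvPolynomial W ℂ, Tendsto (fun x : ℂ => MvPolynomial.eval
          (Function.update v k.1 (k.2.2 * v k.2.1 + x)) M) (𝓝[≠] 0)
          (𝓝 (MvPolynomial.eval (Function.update v k.1 (k.2.2 * v k.2.1)) M)) := by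
        intro M
        have : Continuous (fun x : ℂ => MvPolynomial.eval
          (Function.update v k.1 (k.2.2 * v k.2.1 + x)) M) :=
          (MvPolynomial.continuous_eval M).comp
            (continuous_const.update k.1 (continuous_const.add continuous_id))
        simpa using (this.tendsto 0).mono_left (nhdsWithin_le_nhds (s := {0}ᶜ))
      have hprod := (hcont (L.map linForm).prod).mul hv
      rw [mul_zero] at hprod
      refine tendsto_nhds_unique ((hcont N).congr' ?_) hprod
      filter_upwards [hshift.eventually (hupd k.1 (k.2.2 * v k.2.1))] with x hx
      rw [hx, List.map_cons, List.prod_cons, map_mul]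
      simp only [linForm, map_sub, map_mul, MvPolynomial.eval_X, MvPolynomial.eval_C,
        Function.update_self, Function.update_of_ne hne]
      ring
    obtain ⟨N', rfl⟩ := hdvd
    refine ih (fun k hk => hL k (by simp [hk])) N' ?_
    filter_upwards [hN, eventually_mul_ne_mul hne one_ne_zero k.2.2] with v hv hkv
    have h0 : MvPolynomial.eval v (linForm k) ≠ 0 := by
      simpa [linForm, sub_eq_zero] using hkv
    rw [map_mul, List.map_cons, List.prod_cons, map_mul, mul_assoc] at hv
    exact mul_left_cancel₀ h0 hv

end HasLinearDenominators

end Zariski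

section Residues

open Filter Topology

/-- The inverse, with value `1` at `0`. -/
def regInv (a : ℂ) : ℂ := if a = 0 then 1 else a⁻¹

theorem regInv_of_ne {a : ℂ} (h : a ≠ 0) : regInv a = a⁻¹ := if_neg h

theorem tendsto_mul_prod_div_of_ne {ι : Type*} (T : Finset ι) (num den : ι → ℂ → ℂ)
    (hnum : ∀ k, Continuous (num k)) (hden : ∀ k, Continuous (den k))
    (h : ∀ k ∈ T, den k 0 ≠ 0) :
    Tendsto (fun x : ℂ => x * ∏ k ∈ T, num k x / den k x) (𝓝[≠] 0) (𝓝 0) := by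
  have h1 : Tendsto (fun x : ℂ => x * ∏ k ∈ T, num k x / den k x) (𝓝 0)
      (𝓝 (0 * ∏ k ∈ T, num k 0 / den k 0)) :=
    tendsto_id.mul (tendsto_finsetProd _ fun k hk =>
      ((hnum k).tendsto 0).div ((hden k).tendsto 0) (h k hk))
  rw [zero_mul] at h1
  exact h1.mono_left nhdsWithin_le_nhds

theorem tendsto_mul_prod_div_of_unique {ι : Type*} [DecidableEq ι] (T : Finset ι)
    (num den : ι → ℂ → ℂ) (hnum : ∀ k, Continuous (num k)) (hden : ∀ k, Continuous (den k))
    (k₀ : ι) (hk₀ : k₀ ∈ T) (c : ℂ) (hc : c ≠ 0) (hden₀ : ∀ x, den k₀ x = c * x)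
    (h : ∀ k ∈ T, k ≠ k₀ → den k 0 ≠ 0) :
    Tendsto (fun x : ℂ => x * ∏ k ∈ T, num k x / den k x) (𝓝[≠] 0)
      (𝓝 (c⁻¹ * ∏ k ∈ T, num k 0 * regInv (den k 0))) := by
  have h1 : Tendsto (fun x : ℂ => c⁻¹ * (num k₀ x * ∏ k ∈ T.erase k₀, num k x / den k x))
      (𝓝[≠] 0) (𝓝 (c⁻¹ * (num k₀ 0 * ∏ k ∈ T.erase k₀, num k 0 / den k 0))) := by
    refine Tendsto.mono_left ?_ nhdsWithin_le_nhds
    refine tendsto_const_nhds.mul (((hnum k₀).tendsto 0).mul (tendsto_finsetProd _ fun k hk => ?_))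
    exact ((hnum k).tendsto 0).div ((hden k).tendsto 0)
      (h k (Finset.mem_of_mem_erase hk) (Finset.ne_of_mem_erase hk))
  have h2 : ∏ k ∈ T, num k 0 * regInv (den k 0)
      = num k₀ 0 * ∏ k ∈ T.erase k₀, num k 0 / den k 0 := by
    rw [← Finset.mul_prod_erase T _ hk₀]
    congr 1
    · simp [hden₀, regInv]
    · refine Finset.prod_congr rfl fun k hk => ?_
      rw [regInv_of_ne (h k (Finset.mem_of_mem_erase hk) (Finset.ne_of_mem_erase hk)),
        div_eq_mul_inv]
  rw [h2]
  refine h1.congr' ?_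
  filter_upwards [self_mem_nhdsWithin] with x hx
  have hx' : x ≠ 0 := hx
  rw [← Finset.mul_prod_erase T _ hk₀, hden₀]
  field_simp

variable {V : Type*} [DecidableEq V]

/-- The lengths of the strings obtained from `ν` by exchanging the end points of the strings
starting at `a u` and `a w`, where `a w = q ^ d * a u`. -/
def exchange (u w : V) (d : ℕ) (ν : V → ℕ) : V → ℕ :=
  Function.update (Function.update ν u (ν w + d)) w (ν u - d)

theorem exchange_left {u w : V} (huw : u ≠ w) (d : ℕ) (ν : V → ℕ) :
    exchange u w d ν u = ν w + d := by
  simp [exchange, huw]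

theorem exchange_right (u w : V) (d : ℕ) (ν : V → ℕ) : exchange u w d ν w = ν u - d := by
  simp [exchange]

theorem exchange_of_ne {u w k : V} (hu : k ≠ u) (hw : k ≠ w) (d : ℕ) (ν : V → ℕ) :
    exchange u w d ν k = ν k := by
  simp [exchange, hu, hw]

theorem exchange_exchange {u w : V} (huw : u ≠ w) {d : ℕ} {ν : V → ℕ} (h : d ≤ ν u) :
    exchange u w d (exchange u w d ν) = ν := by
  funext k
  by_cases hw : k = w
  · subst hw
    rw [exchange_right, exchange_left huw]
    omega
  by_cases hu : k = u
  · subst hu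
    rw [exchange_left huw, exchange_right]
    omega
  rw [exchange_of_ne hu hw, exchange_of_ne hu hw]

theorem endpoints_exchange {q : ℂ} {u w : V} (huw : u ≠ w) {d : ℕ} {ν : V → ℕ}
    (h : d ≤ ν u) {v : V → ℂ} (hv : v w = q ^ d * v u) (k : V) :
    q ^ exchange u w d ν k * v k = q ^ ν (Equiv.swap u w k) * v (Equiv.swap u w k) := by
  by_cases hw : k = w
  · subst hw
    rw [exchange_right, Equiv.swap_apply_right, hv, ← mul_assoc, ← pow_add, Nat.sub_add_cancel h]
  by_cases hu : k = u
  · subst hu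
    rw [exchange_left huw, Equiv.swap_apply_left, hv, pow_add, mul_assoc]
  rw [exchange_of_ne hu hw, Equiv.swap_apply_of_ne_of_ne hu hw]

variable [Fintype V]

theorem prod_univ_eq_pair_mul {M : Type*} [CommMonoid M] {u w : V} (huw : u ≠ w) (f : V → M) :
    ∏ k, f k = f u * f w * ∏ k ∈ (Finset.univ.erase u).erase w, f k := by
  rw [← Finset.mul_prod_erase Finset.univ f (Finset.mem_univ u),
    ← Finset.mul_prod_erase (Finset.univ.erase u) f
      (Finset.mem_erase.2 ⟨huw.symm, Finset.mem_univ w⟩), mul_assoc]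

theorem sum_exchange {u w : V} (huw : u ≠ w) {d : ℕ} {ν : V → ℕ} (h : d ≤ ν u) :
    ∑ k, exchange u w d ν k = ∑ k, ν k := by
  have key := prod_univ_eq_pair_mul (M := Multiplicative ℕ) huw
  have h1 : ∀ f : V → ℕ, ∑ k, f k = f u + f w + ∑ k ∈ (Finset.univ.erase u).erase w, f k :=
    fun f => key f
  rw [h1, h1, exchange_left huw, exchange_right,
    Finset.sum_congr rfl fun k hk => exchange_of_ne (u := u) (w := w) (by simp_all) (by simp_all) d ν]
  omega

theorem prod_strings_exchange {q : ℂ} {u w : V} (huw : u ≠ w) {d : ℕ} {ν : V → ℕ}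
    (h : d ≤ ν u) {v : V → ℂ} (hv : v w = q ^ d * v u) (Ψ : ℂ → ℂ) :
    ∏ k, ∏ b ∈ Finset.range (exchange u w d ν k), Ψ (q ^ b * v k)
      = ∏ k, ∏ b ∈ Finset.range (ν k), Ψ (q ^ b * v k) := by
  rw [prod_univ_eq_pair_mul huw, prod_univ_eq_pair_mul huw, exchange_left huw, exchange_right]
  congr 1
  · obtain ⟨e, he⟩ := Nat.exists_eq_add_of_le h
    rw [he, Nat.add_sub_cancel_left, add_comm (ν w) d, Finset.prod_range_add,
      Finset.prod_range_add]
    have hs : ∀ b, Ψ (q ^ b * v w) = Ψ (q ^ (d + b) * v u) := by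
      intro b
      rw [hv, pow_add]
      ring_nf
    simp only [hs]
    ring
  · refine Finset.prod_congr rfl fun k hk => ?_
    rw [exchange_of_ne (by simp_all) (by simp_all)]

end Residues

section StringCoefficients

open Filter Topology

variable {n m : ℕ}

/-- The numerators of the coefficients attached to families of strings. -/
def numFactor (q z : ℂ) : Fin n ⊕ Fin m → ℂ → ℂ → ℂ
  | .inl _, a, σ => a - z * σ
  | .inr _, a, σ => q * a - σ

theorem continuous_numFactor (q z : ℂ) (w : Fin n ⊕ Fin m) {X : Type*} [TopologicalSpace X]
    {f g : X → ℂ} (hf : Continuous f) (hg : Continuous g) :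
    Continuous (fun x => numFactor q z w (f x) (g x)) := by
  cases w <;> simp only [numFactor] <;> fun_prop

/-- The coefficient attached to the family of strings `v u, q v u, …, q ^ (ν u - 1) v u`. -/
def stringCoef (q z : ℂ) (ν : Fin n ⊕ Fin m → ℕ) (v : Fin n ⊕ Fin m → ℂ) : ℂ :=
  ∏ u, ∏ b ∈ Finset.range (ν u), ∏ w,
    numFactor q z w (v w) (q ^ b * v u) / (q ^ ν w * v w - q ^ b * v u)

/-- The coefficient `stringCoef` with its vanishing denominators omitted. -/
def regStringCoef (q z : ℂ) (ν : Fin n ⊕ Fin m → ℕ) (v : Fin n ⊕ Fin m → ℂ) : ℂ :=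
  ∏ u, ∏ b ∈ Finset.range (ν u), ∏ w,
    numFactor q z w (v w) (q ^ b * v u) * regInv (q ^ ν w * v w - q ^ b * v u)

/-- The shift of the variables attached to a family of strings. -/
def stringShift (q t : ℂ) (ν : Fin n ⊕ Fin m → ℕ) (v : Fin n ⊕ Fin m → ℂ) :
    Fin n ⊕ Fin m → ℂ :=
  fun w => Sum.elim (fun _ => q) (fun _ => t⁻¹) w ^ ν w * v w

/-- The variables are nonzero, and no two of them have a ratio `q ^ k` with `|k| ≤ K`. -/
def InGeneralPosition {V : Type*} (q : ℂ) (K : ℕ) (v : V → ℂ) : Prop :=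
  (∀ u, v u ≠ 0) ∧ ∀ u w, u ≠ w → ∀ k ≤ K, ∀ l ≤ K, q ^ k * v w ≠ q ^ l * v u

theorem pow_ne_pow {q : ℂ} (hq0 : q ≠ 0) (hq : ∀ k : ℕ, 1 ≤ k → q ^ k ≠ 1) {a b : ℕ}
    (hab : a < b) : q ^ b ≠ q ^ a := by
  intro h
  obtain ⟨c, rfl⟩ := Nat.exists_eq_add_of_lt hab
  rw [add_assoc, pow_add] at h
  exact hq (c + 1) (by omega) (mul_left_cancel₀ (pow_ne_zero a hq0) (h.trans (mul_one _).symm))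

theorem regStringCoef_exchange {q : ℂ} (z : ℂ) {u w : Fin n ⊕ Fin m} (huw : u ≠ w) {d : ℕ}
    {ν : Fin n ⊕ Fin m → ℕ} (h : d ≤ ν u) {v : Fin n ⊕ Fin m → ℂ} (hv : v w = q ^ d * v u) :
    regStringCoef q z (exchange u w d ν) v = regStringCoef q z ν v := by
  have key := prod_strings_exchange huw h hv (fun σ =>
    ∏ w, numFactor q z w (v w) σ * regInv (q ^ ν w * v w - σ))
  rw [regStringCoef, regStringCoef, ← key]
  refine Finset.prod_congr rfl fun k _ => Finset.prod_congr rfl fun b _ => ?_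
  rw [Finset.prod_mul_distrib, Finset.prod_mul_distrib]
  congr 1
  simp only [endpoints_exchange huw h hv]
  exact Equiv.prod_comp (Equiv.swap u w) (fun k' => regInv (q ^ ν k' * v k' - q ^ b * v k))

/-- The coefficient of `regStringCoef` in the residue of `stringCoef`. -/
def residueCoef {V : Type*} (q : ℂ) (u w : V) (d : ℕ) (ν : V → ℕ) : ℂ :=
  if d ≤ ν u then
    if d + ν w < ν u then (q ^ ν w)⁻¹ else if ν u < d + ν w then -(q ^ (ν u - d))⁻¹ else 0
  else 0

theorem residueCoef_exchange {V : Type*} [Fintype V] [DecidableEq V] (q : ℂ) {u w : V}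
    (huw : u ≠ w) {d : ℕ} {ν : V → ℕ} (h : d ≤ ν u) :
    residueCoef q u w d (exchange u w d ν) = -residueCoef q u w d ν := by
  simp only [residueCoef, exchange_left huw, exchange_right]
  rcases lt_trichotomy (d + ν w) (ν u) with h1 | h1 | h1
  · rw [if_pos (by omega), if_neg (by omega), if_pos (by omega), if_pos h, if_pos h1,
      Nat.add_sub_cancel]
  · rw [if_pos (by omega), if_neg (by omega), if_neg (by omega), if_pos h, if_neg (by omega),
      if_neg (by omega), neg_zero]
  · rw [if_pos (by omega), if_pos (by omega), if_pos h, if_neg (by omega), if_pos h1, neg_neg]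

theorem tendsto_mul_stringCoef {q : ℂ} (hq0 : q ≠ 0) (hq : ∀ k : ℕ, 1 ≤ k → q ^ k ≠ 1) (z : ℂ)
    {u w : Fin n ⊕ Fin m} (huw : u ≠ w) (d s : ℕ) {ν : Fin n ⊕ Fin m → ℕ} (hν : ∀ k, ν k ≤ s)
    {v : Fin n ⊕ Fin m → ℂ} (hv : InGeneralPosition q (d + s) v) :
    Tendsto (fun x : ℂ => x * stringCoef q z ν (Function.update v w (q ^ d * v u + x)))
      (𝓝[≠] 0) (𝓝 (residueCoef q u w d ν
        * regStringCoef q z ν (Function.update v w (q ^ d * v u)))) := by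
  set T : Finset ((_ : Fin n ⊕ Fin m) × (_ : ℕ) × (Fin n ⊕ Fin m)) :=
    Finset.univ.sigma fun k => (Finset.range (ν k)).sigma fun _ => Finset.univ with hT
  set p : ℂ → Fin n ⊕ Fin m → ℂ := fun x => Function.update v w (q ^ d * v u + x) with hp
  set num : ((_ : Fin n ⊕ Fin m) × (_ : ℕ) × (Fin n ⊕ Fin m)) → ℂ → ℂ :=
    fun k x => numFactor q z k.2.2 (p x k.2.2) (q ^ k.2.1 * p x k.1) with hnum
  set den : ((_ : Fin n ⊕ Fin m) × (_ : ℕ) × (Fin n ⊕ Fin m)) → ℂ → ℂ :=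
    fun k x => q ^ ν k.2.2 * p x k.2.2 - q ^ k.2.1 * p x k.1 with hden
  have hpc : ∀ k, Continuous fun x => p x k := by
    intro k
    by_cases hk : k = w
    · subst hk
      simp only [hp, Function.update_self]
      fun_prop
    · simp only [hp, Function.update_of_ne hk]
      fun_prop
  have hnumc : ∀ k, Continuous (num k) := fun k =>
    continuous_numFactor q z _ (hpc _) (continuous_const.mul (hpc _))
  have hdenc : ∀ k, Continuous (den k) := fun k =>
    (continuous_const.mul (hpc _)).sub (continuous_const.mul (hpc _))
  have hprod : ∀ x, stringCoef q z ν (p x) = ∏ k ∈ T, num k x / den k x := by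
    intro x
    rw [hT, Finset.prod_sigma, stringCoef]
    simp only [Finset.prod_sigma, hnum, hden]
  have hreg : regStringCoef q z ν (p 0) = ∏ k ∈ T, num k 0 * regInv (den k 0) := by
    rw [hT, Finset.prod_sigma, regStringCoef]
    simp only [Finset.prod_sigma, hnum, hden]
  have hp0 : Function.update v w (q ^ d * v u) = p 0 := by simp [hp]
  have hpw : ∀ x, p x w = q ^ d * v u + x := by simp [hp]
  have hpk : ∀ x k, k ≠ w → p x k = v k := by
    intro x k hk
    simp [hp, hk]
  have hzero : ∀ k ∈ T, den k 0 = 0 →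
      (k.1 = u ∧ k.2.2 = w ∧ k.2.1 = d + ν w) ∨ (k.1 = w ∧ k.2.2 = u ∧ k.2.1 + d = ν u) := by
    rintro ⟨k, b, l⟩ hk h0
    simp only [hT, Finset.mem_sigma, Finset.mem_univ, Finset.mem_range, true_and,
      and_true] at hk
    simp only [hden, sub_eq_zero] at h0
    have hb : b < s := hk.trans_le (hν k)
    have hl := hν l
    by_cases hkl : k = l
    · subst hkl
      have hne : p 0 k ≠ 0 := by
        by_cases hkw : k = w
        · subst hkw
          rw [hpw, add_zero]
          exact mul_ne_zero (pow_ne_zero _ hq0) (hv.1 u)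
        · rw [hpk 0 k hkw]
          exact hv.1 k
      exact absurd (mul_right_cancel₀ hne h0) (pow_ne_pow hq0 hq hk)
    by_cases hkw : k = w
    · subst hkw
      rw [hpw, hpk 0 l (Ne.symm hkl), add_zero, ← mul_assoc, ← pow_add] at h0
      by_cases hlu : l = u
      · subst hlu
        refine Or.inr ⟨rfl, rfl, ?_⟩
        have h1 := mul_right_cancel₀ (hv.1 l) h0
        rcases lt_trichotomy (b + d) (ν l) with h2 | h2 | h2
        · exact absurd h1 (pow_ne_pow hq0 hq h2)
        · exact h2
        · exact absurd h1.symm (pow_ne_pow hq0 hq h2)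
      · exact absurd h0 (hv.2 u l (Ne.symm hlu) _ (by omega) _ (by omega))
    by_cases hlw : l = w
    · subst hlw
      rw [hpw, hpk 0 k hkw, add_zero, ← mul_assoc, ← pow_add] at h0
      by_cases hku : k = u
      · subst hku
        refine Or.inl ⟨rfl, rfl, ?_⟩
        have h1 := mul_right_cancel₀ (hv.1 k) h0
        rcases lt_trichotomy (ν l + d) b with h2 | h2 | h2
        · exact absurd h1.symm (pow_ne_pow hq0 hq h2)
        · simp only
          omega
        · exact absurd h1 (pow_ne_pow hq0 hq h2)
      · exact absurd h0 (hv.2 k u hku _ (by omega) _ (by omega))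
    rw [hpk 0 k hkw, hpk 0 l hlw] at h0
    exact absurd h0 (hv.2 k l hkl _ (by omega) _ (by omega))
  rw [hp0, hreg]
  simp only [show ∀ x, Function.update v w (q ^ d * v u + x) = p x from fun x => rfl, hprod]
  have hnone : (¬ d ≤ ν u ∨ d + ν w = ν u) → ∀ k ∈ T, den k 0 ≠ 0 := by
    rintro hor ⟨k, b, l⟩ hk h0
    have hk' := hk
    simp only [hT, Finset.mem_sigma, Finset.mem_univ, Finset.mem_range, true_and,
      and_true] at hk'
    rcases hzero _ hk h0 with ⟨h2, h3, h1⟩ | ⟨h2, h3, h1⟩ <;> dsimp only at h1 h2 h3 <;>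
      rw [h2] at hk' <;> omega
  unfold residueCoef
  split_ifs with h1 h2 h3
  · refine tendsto_mul_prod_div_of_unique T num den hnumc hdenc ⟨u, d + ν w, w⟩
      (by simpa [hT] using h2) _ (pow_ne_zero _ hq0) ?_ ?_
    · intro x
      simp only [hden, hpw, hpk x u huw]
      ring
    · rintro ⟨k, b, l⟩ hk hne h0
      have hk' := hk
      simp only [hT, Finset.mem_sigma, Finset.mem_univ, Finset.mem_range, true_and,
        and_true] at hk'
      rcases hzero _ hk h0 with ⟨h3, h4, h5⟩ | ⟨h3, h4, h5⟩ <;> dsimp only at h3 h4 h5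
      · exact hne (by rw [h3, h4, h5])
      · rw [h3] at hk'
        omega
  · rw [← inv_neg]
    refine tendsto_mul_prod_div_of_unique T num den hnumc hdenc ⟨w, ν u - d, u⟩
      ?_ _ (neg_ne_zero.2 (pow_ne_zero _ hq0)) ?_ ?_
    · simp only [hT, Finset.mem_sigma, Finset.mem_univ, Finset.mem_range, true_and, and_true]
      omega
    · intro x
      simp only [hden, hpw, hpk x u huw]
      have : q ^ ν u = q ^ (ν u - d) * q ^ d := by rw [← pow_add, Nat.sub_add_cancel h1]
      rw [this]
      ring
    · rintro ⟨k, b, l⟩ hk hne h0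
      have hk' := hk
      simp only [hT, Finset.mem_sigma, Finset.mem_univ, Finset.mem_range, true_and,
        and_true] at hk'
      rcases hzero _ hk h0 with ⟨h4, h5, h6⟩ | ⟨h4, h5, h6⟩ <;> dsimp only at h4 h5 h6
      · rw [h4] at hk'
        omega
      · exact hne (by rw [h4, h5, show b = ν u - d by omega])
  · rw [zero_mul]
    exact tendsto_mul_prod_div_of_ne T num den hnumc hdenc (hnone (Or.inr (by omega)))
  · rw [zero_mul]
    exact tendsto_mul_prod_div_of_ne T num den hnumc hdenc (hnone (Or.inl h1))

end StringCoefficients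

section Lambda

variable {n m : ℕ} {q t : ℂ} {p : MvPolynomial (Fin n ⊕ Fin m) ℂ}

theorem memLambda.eval_comp_sumMap (hp : memLambda n m q t p) (σ : Equiv.Perm (Fin n))
    (τ : Equiv.Perm (Fin m)) (a : Fin n ⊕ Fin m → ℂ) :
    MvPolynomial.eval (a ∘ Sum.map σ τ) p = MvPolynomial.eval a p := by
  have h := hp.1 σ τ (a ∘ Sum.inl) (a ∘ Sum.inr)
  simp only [evalXY, Sum.elim_comp_inl_inr] at h
  rw [← h]
  congr 2
  funext k
  cases k <;> rfl

theorem memLambda.eval_eq_eval (hp : memLambda n m q t p) (i : Fin n) (j : Fin m) (c : ℂ)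
    {a b : Fin n ⊕ Fin m → ℂ} (hai : a (.inl i) = q * c) (haj : a (.inr j) = c)
    (hbi : b (.inl i) = c) (hbj : b (.inr j) = t⁻¹ * c)
    (hab : ∀ k, k ≠ .inl i → k ≠ .inr j → a k = b k) :
    MvPolynomial.eval a p = MvPolynomial.eval b p := by
  have h := hp.2 i j (b ∘ Sum.inl) (a ∘ Sum.inr) (by simp [hbi, haj])
  simp only [evalXY] at h
  have h1 : Sum.elim (Function.update (b ∘ Sum.inl) i (q * (b ∘ Sum.inl) i)) (a ∘ Sum.inr)
      = a := by
    funext k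
    rcases k with k | k
    · by_cases hk : k = i
      · subst hk
        simp [hbi, hai]
      · simp [hk, hab (.inl k) (by simpa using hk) (by simp)]
    · rfl
  have h2 : Sum.elim (b ∘ Sum.inl) (Function.update (a ∘ Sum.inr) j (t⁻¹ * (a ∘ Sum.inr) j))
      = b := by
    funext k
    rcases k with k | k
    · rfl
    · by_cases hk : k = j
      · subst hk
        simp [hbj, haj]
      · simp [hk, hab (.inr k) (by simp) (by simpa using hk)]
  rwa [h1, h2] at h

theorem memLambda.eval_stringShift_exchange (hp : memLambda n m q t p) {u w : Fin n ⊕ Fin m}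
    (huw : u ≠ w) {d : ℕ} {ν : Fin n ⊕ Fin m → ℕ} (h : d ≤ ν u) (hν : ∀ j, ν (.inr j) ≤ 1)
    (hν' : ∀ j, exchange u w d ν (.inr j) ≤ 1) (hres : residueCoef q u w d ν ≠ 0)
    {v : Fin n ⊕ Fin m → ℂ} (hv : v w = q ^ d * v u) :
    MvPolynomial.eval (stringShift q t (exchange u w d ν) v) p
      = MvPolynomial.eval (stringShift q t ν v) p := by
  have hne : d + ν w ≠ ν u := by
    intro h0
    apply hres
    simp [residueCoef, h0]
  have hex : ∀ k, k ≠ u → k ≠ w →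
      stringShift q t (exchange u w d ν) v k = stringShift q t ν v k := by
    intro k hu hw
    simp only [stringShift, exchange_of_ne hu hw]
  have hu' : exchange u w d ν u = ν w + d := exchange_left huw d ν
  have hw' : exchange u w d ν w = ν u - d := exchange_right u w d ν
  rcases u with i | j <;> rcases w with k | l
  · rw [← hp.eval_comp_sumMap (Equiv.swap i k) 1]
    congr 2
    funext a
    rcases a with a | a
    · by_cases hai : a = i
      · subst hai
        simp only [Function.comp_apply, Sum.map_inl, Equiv.swap_apply_left, stringShift, hw', hv,
          Sum.elim_inl]
        rw [← mul_assoc, ← pow_add, Nat.sub_add_cancel h]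
      · by_cases hak : a = k
        · subst hak
          simp only [Function.comp_apply, Sum.map_inl, Equiv.swap_apply_right, stringShift, hu', hv,
            Sum.elim_inl]
          ring
        · simp only [Function.comp_apply, Sum.map_inl, Equiv.swap_apply_of_ne_of_ne hai hak]
          exact hex _ (by simpa using hai) (by simpa using hak)
    · exact hex _ (by simp) (by simp)
  · have h1 := hν l
    have h2 := hν' l
    rw [hw'] at h2
    have h3 : ν (.inr l) = 0 ∧ ν (.inl i) = d + 1 ∨ ν (.inr l) = 1 ∧ ν (.inl i) = d := by omega
    rcases h3 with ⟨h3, h4⟩ | ⟨h3, h4⟩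
    · refine (hp.eval_eq_eval i l (q ^ d * v (.inl i)) ?_ ?_ ?_ ?_ ?_).symm
      · simp only [stringShift, h4, Sum.elim_inl]
        ring
      · simp [stringShift, h3, hv]
      · simp [stringShift, hu', h3]
      · simp [stringShift, hw', h4, hv]
      · exact fun k h5 h6 => (hex k h5 h6).symm
    · refine hp.eval_eq_eval i l (q ^ d * v (.inl i)) ?_ ?_ ?_ ?_ ?_
      · simp only [stringShift, hu', h3, Sum.elim_inl]
        ring
      · simp [stringShift, hw', h4, hv]
      · simp [stringShift, h4]
      · simp [stringShift, h3, hv]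
      · exact fun k h5 h6 => hex k h5 h6
  · have h1 := hν j
    have h2 := hν' j
    rw [hu'] at h2
    obtain rfl : d = 0 := by omega
    rw [pow_zero, one_mul] at hv
    have h3 : ν (.inl k) = 0 ∧ ν (.inr j) = 1 ∨ ν (.inl k) = 1 ∧ ν (.inr j) = 0 := by omega
    rcases h3 with ⟨h3, h4⟩ | ⟨h3, h4⟩
    · refine hp.eval_eq_eval k j (v (.inr j)) ?_ ?_ ?_ ?_ ?_
      · simp [stringShift, hw', h4, hv]
      · simp [stringShift, hu', h3]
      · simp [stringShift, h3, hv]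
      · simp [stringShift, h4]
      · exact fun k h5 h6 => hex k h6 h5
    · refine (hp.eval_eq_eval k j (v (.inr j)) ?_ ?_ ?_ ?_ ?_).symm
      · simp [stringShift, h3, hv]
      · simp [stringShift, h4]
      · simp [stringShift, hw', h4, hv]
      · simp [stringShift, hu', h3]
      · exact fun k h5 h6 => (hex k h6 h5).symm
  · have h1 := hν j
    have h2 := hν' j
    rw [hu'] at h2
    obtain rfl : d = 0 := by omega
    rw [pow_zero, one_mul] at hv
    rw [← hp.eval_comp_sumMap 1 (Equiv.swap j l)]
    congr 2
    funext a
    rcases a with a | a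
    · exact hex _ (by simp) (by simp)
    · by_cases haj : a = j
      · subst haj
        simp [stringShift, hw', hv]
      · by_cases hal : a = l
        · subst hal
          simp [stringShift, hu', hv]
        · simp only [Function.comp_apply, Sum.map_inr, Equiv.swap_apply_of_ne_of_ne haj hal]
          exact hex _ (by simpa using haj) (by simpa using hal)

end Lambda

section StringSum

open Filter Topology

variable {n m : ℕ}

theorem stringCoef_eq_zero (q z : ℂ) {ν : Fin n ⊕ Fin m → ℕ} {j : Fin m} (h : 1 < ν (.inr j))
    (v : Fin n ⊕ Fin m → ℂ) : stringCoef q z ν v = 0 := by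
  refine Finset.prod_eq_zero (Finset.mem_univ (Sum.inr j)) ?_
  refine Finset.prod_eq_zero (Finset.mem_range.2 h) ?_
  refine Finset.prod_eq_zero (Finset.mem_univ (Sum.inr j)) ?_
  simp [numFactor]

theorem regStringCoef_eq_zero (q z : ℂ) {ν : Fin n ⊕ Fin m → ℕ} {j : Fin m}
    (h : 1 < ν (.inr j)) (v : Fin n ⊕ Fin m → ℂ) : regStringCoef q z ν v = 0 := by
  refine Finset.prod_eq_zero (Finset.mem_univ (Sum.inr j)) ?_
  refine Finset.prod_eq_zero (Finset.mem_range.2 h) ?_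
  refine Finset.prod_eq_zero (Finset.mem_univ (Sum.inr j)) ?_
  simp [numFactor]

theorem le_of_mem_piAntidiag {V : Type*} [Fintype V] [DecidableEq V] {s : ℕ} {ν : V → ℕ}
    (h : ν ∈ Finset.piAntidiag Finset.univ s) (k : V) : ν k ≤ s := by
  rw [Finset.mem_piAntidiag] at h
  rw [← h.1]
  exact Finset.single_le_sum (f := ν) (fun _ _ => Nat.zero_le _) (Finset.mem_univ k)

/-- The residues of the sum of the terms attached to the families of `s` string elements
cancel. -/
theorem tendsto_mul_sum_stringCoef {q t : ℂ} (hq0 : q ≠ 0) (hq : ∀ k : ℕ, 1 ≤ k → q ^ k ≠ 1)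
    (z : ℂ) {p : MvPolynomial (Fin n ⊕ Fin m) ℂ} (hp : memLambda n m q t p)
    {u w : Fin n ⊕ Fin m} (huw : u ≠ w) (d s : ℕ) {v : Fin n ⊕ Fin m → ℂ}
    (hv : InGeneralPosition q (d + s) v) :
    Tendsto (fun x : ℂ => x * ∑ ν ∈ Finset.piAntidiag Finset.univ s,
      stringCoef q z ν (Function.update v w (q ^ d * v u + x))
        * MvPolynomial.eval (stringShift q t ν (Function.update v w (q ^ d * v u + x))) p)
      (𝓝[≠] 0) (𝓝 0) := by
  set v₀ := Function.update v w (q ^ d * v u) with hv₀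
  have hv₀w : v₀ w = q ^ d * v₀ u := by simp [hv₀, huw]
  have hF : ∀ ν, Tendsto (fun x : ℂ =>
      MvPolynomial.eval (stringShift q t ν (Function.update v w (q ^ d * v u + x))) p)
      (𝓝[≠] 0) (𝓝 (MvPolynomial.eval (stringShift q t ν v₀) p)) := by
    intro ν
    have hc : Continuous (fun x : ℂ =>
        MvPolynomial.eval (stringShift q t ν (Function.update v w (q ^ d * v u + x))) p) := by
      have hu : Continuous fun x : ℂ => Function.update v w (q ^ d * v u + x) :=
        continuous_const.update w (continuous_const.add continuous_id)
      exact (MvPolynomial.continuous_eval p).comp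
        (continuous_pi fun k => continuous_const.mul ((continuous_apply k).comp hu))
    simpa using (hc.tendsto 0).mono_left (nhdsWithin_le_nhds (s := {0}ᶜ))
  have hsum : ∑ ν ∈ Finset.piAntidiag Finset.univ s, residueCoef q u w d ν
      * regStringCoef q z ν v₀ * MvPolynomial.eval (stringShift q t ν v₀) p = 0 := by
    have hz : ∀ ν : Fin n ⊕ Fin m → ℕ, residueCoef q u w d ν * regStringCoef q z ν v₀
        * MvPolynomial.eval (stringShift q t ν v₀) p ≠ 0 →
        d ≤ ν u ∧ residueCoef q u w d ν ≠ 0 := by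
      intro ν h
      have h1 := left_ne_zero_of_mul (left_ne_zero_of_mul h)
      refine ⟨?_, h1⟩
      by_contra h2
      simp [residueCoef, h2] at h1
    refine Finset.sum_involution
      (fun ν _ => if d ≤ ν u then exchange u w d ν else ν) ?_ ?_ ?_ ?_
    · intro ν _
      by_cases h : d ≤ ν u
      · rw [if_pos h, residueCoef_exchange q huw h, regStringCoef_exchange z huw h hv₀w]
        by_cases h0 : residueCoef q u w d ν = 0
        · simp [h0]
        by_cases h1 : regStringCoef q z ν v₀ = 0
        · simp [h1]
        have hadm : ∀ j, ν (.inr j) ≤ 1 := by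
          intro j
          by_contra h2
          exact h1 (regStringCoef_eq_zero q z (not_le.1 h2) v₀)
        have hadm' : ∀ j, exchange u w d ν (.inr j) ≤ 1 := by
          intro j
          by_contra h2
          exact h1 (by
            rw [← regStringCoef_exchange z huw h hv₀w]
            exact regStringCoef_eq_zero q z (not_le.1 h2) v₀)
        rw [hp.eval_stringShift_exchange huw h hadm hadm' h0 hv₀w]
        ring
      · rw [if_neg h]
        simp [residueCoef, h]
    · intro ν _ h h'
      obtain ⟨h1, h2⟩ := hz ν h
      rw [if_pos h1] at h'
      have h3 := congrFun h' w
      rw [exchange_right] at h3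
      apply h2
      rw [residueCoef, if_pos h1, if_neg (by omega), if_neg (by omega)]
    · intro ν hν
      split_ifs with h
      · rw [Finset.mem_piAntidiag] at hν ⊢
        exact ⟨(sum_exchange huw h).trans hν.1, fun _ _ => Finset.mem_univ _⟩
      · exact hν
    · intro ν hν
      by_cases h : d ≤ ν u
      · simp only [if_pos h]
        rw [if_pos (by rw [exchange_left huw]; omega), exchange_exchange huw h]
      · simp only [if_neg h]
  have hlim := tendsto_finsetSum (Finset.piAntidiag Finset.univ s) fun ν hν =>
    (tendsto_mul_stringCoef hq0 hq z huw d s (le_of_mem_piAntidiag hν) hv).mul (hF ν)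
  rw [hsum] at hlim
  simpa only [Finset.mul_sum, ← mul_assoc] using hlim

end StringSum

section StringSum

open Filter Topology

variable {n m : ℕ}

/-- The factors of `stringCoef`, without those that cancel when `ν (.inr j) ≤ 1` for all `j`. -/
def stringFactor (q z : ℂ) (ν : Fin n ⊕ Fin m → ℕ) (v : Fin n ⊕ Fin m → ℂ) (σ : ℂ)
    (w : Fin n ⊕ Fin m) : ℂ :=
  if w.isRight ∧ ν w ≠ 0 then 1 else numFactor q z w (v w) σ / (q ^ ν w * v w - σ)

/-- The coefficient `stringCoef`, without the factors that cancel when `ν (.inr j) ≤ 1` for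
all `j`. -/
def redCoef (q z : ℂ) (ν : Fin n ⊕ Fin m → ℕ) (v : Fin n ⊕ Fin m → ℂ) : ℂ :=
  ∏ u, ∏ b ∈ Finset.range (ν u), ∏ w, stringFactor q z ν v (q ^ b * v u) w

variable (n m) in
/-- The lengths of families of `s` string elements, with at most one for each variable `y_j`. -/
def stringIndex (s : ℕ) : Finset (Fin n ⊕ Fin m → ℕ) :=
  {ν ∈ Finset.piAntidiag Finset.univ s | ∀ j : Fin m, ν (.inr j) ≤ 1}

theorem mem_stringIndex {s : ℕ} {ν : Fin n ⊕ Fin m → ℕ} :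
    ν ∈ stringIndex n m s ↔ ∑ k, ν k = s ∧ ∀ j : Fin m, ν (.inr j) ≤ 1 := by
  simp [stringIndex]

/-- The sum of `redCoef` times shifts of `p` over all families of `s` string elements. -/
def stringSum (q t : ℂ) (p : MvPolynomial (Fin n ⊕ Fin m) ℂ) (s : ℕ) (z : ℂ)
    (v : Fin n ⊕ Fin m → ℂ) : ℂ :=
  ∑ ν ∈ stringIndex n m s, redCoef q z ν v * MvPolynomial.eval (stringShift q t ν v) p

/-- No denominator occurring in `stringSum` vanishes. -/
def StringRegular (q : ℂ) (s : ℕ) (v : Fin n ⊕ Fin m → ℂ) : Prop :=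
  ∀ ν ∈ stringIndex n m s, ∀ u, ∀ b < ν u, ∀ w, ¬(w.isRight ∧ ν w ≠ 0) →
    q ^ ν w * v w ≠ q ^ b * v u

theorem eventually_inGeneralPosition {q : ℂ} (hq0 : q ≠ 0) (K : ℕ) {V W : Type*} [Finite V]
    {f : V → W} (hf : Function.Injective f) :
    ∀ᶠ ω in zariski W, InGeneralPosition q K (ω ∘ f) := by
  refine Filter.Eventually.and ?_ ?_
  · exact eventually_all.2 fun u => eventually_coord_ne (f u) 0
  · refine eventually_all.2 fun u => eventually_all.2 fun w => ?_
    by_cases huw : u = w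
    · simp [huw]
    have h : ∀ k ∈ Set.Iic K, ∀ᶠ ω : W → ℂ in zariski W, ∀ l ∈ Set.Iic K,
        q ^ k * ω (f w) ≠ q ^ l * ω (f u) := fun k _ =>
      (eventually_all_finite (Set.finite_Iic K)).2 fun l _ =>
        eventually_mul_ne_mul (hf.ne huw) (pow_ne_zero k hq0) _
    filter_upwards [(eventually_all_finite (Set.finite_Iic K)).2 h] with ω hω _ k hk l hl
    exact hω k hk l hl

theorem le_of_mem_stringIndex {s : ℕ} {ν : Fin n ⊕ Fin m → ℕ} (h : ν ∈ stringIndex n m s)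
    (k : Fin n ⊕ Fin m) : ν k ≤ s :=
  le_of_mem_piAntidiag (Finset.mem_of_mem_filter ν h) k

theorem InGeneralPosition.mul_ne_mul {q : ℂ} (hq0 : q ≠ 0) (hq : ∀ k : ℕ, 1 ≤ k → q ^ k ≠ 1)
    {K : ℕ} {V : Type*} {v : V → ℂ} (hv : InGeneralPosition q K v) {k l : ℕ} (hk : k ≤ K)
    (hl : l ≤ K) {u w : V} (h : u = w → l < k) : q ^ k * v w ≠ q ^ l * v u := by
  by_cases huw : u = w
  · subst huw
    exact fun h0 => pow_ne_pow hq0 hq (h rfl) (mul_right_cancel₀ (hv.1 u) h0)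
  · exact hv.2 u w huw k hk l hl

theorem redCoef_eq_stringCoef {q : ℂ} (hq0 : q ≠ 0) (hq : ∀ k : ℕ, 1 ≤ k → q ^ k ≠ 1) (z : ℂ)
    {s : ℕ} {ν : Fin n ⊕ Fin m → ℕ} (hν : ν ∈ stringIndex n m s) {v : Fin n ⊕ Fin m → ℂ}
    (hv : InGeneralPosition q s v) : redCoef q z ν v = stringCoef q z ν v := by
  refine Finset.prod_congr rfl fun u _ => Finset.prod_congr rfl fun b hb =>
    Finset.prod_congr rfl fun w _ => ?_
  rw [stringFactor]
  split_ifs with h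
  · obtain ⟨h1, h2⟩ := h
    rcases w with i | j
    · simp at h1
    have h3 : ν (.inr j) = 1 := by
      have := (mem_stringIndex.1 hν).2 j
      omega
    have hb' := Finset.mem_range.1 hb
    have h4 : q ^ ν (.inr j) * v (.inr j) ≠ q ^ b * v u :=
      hv.mul_ne_mul hq0 hq (le_of_mem_stringIndex hν _)
        (hb'.le.trans (le_of_mem_stringIndex hν _)) (by rintro rfl; exact hb')
    rw [h3, pow_one] at h4 ⊢
    rw [numFactor, div_self (sub_ne_zero.2 h4)]
  · rfl

theorem stringSum_eq_sum_stringCoef {q : ℂ} (hq0 : q ≠ 0) (hq : ∀ k : ℕ, 1 ≤ k → q ^ k ≠ 1)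
    (t : ℂ) (p : MvPolynomial (Fin n ⊕ Fin m) ℂ) {s : ℕ} (z : ℂ) {v : Fin n ⊕ Fin m → ℂ}
    (hv : InGeneralPosition q s v) :
    stringSum q t p s z v = ∑ ν ∈ Finset.piAntidiag Finset.univ s,
      stringCoef q z ν v * MvPolynomial.eval (stringShift q t ν v) p := by
  have h : ∀ ν ∈ stringIndex n m s, redCoef q z ν v * MvPolynomial.eval (stringShift q t ν v) p
      = stringCoef q z ν v * MvPolynomial.eval (stringShift q t ν v) p := fun ν hν => by
    rw [redCoef_eq_stringCoef hq0 hq z hν hv]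
  rw [stringSum, Finset.sum_congr rfl h, stringIndex]
  refine Finset.sum_filter_of_ne fun ν _ hne j => ?_
  by_contra hj
  exact hne (by rw [stringCoef_eq_zero q z (not_le.1 hj), zero_mul])

theorem eval_bind₁ {V W : Type*} (ω : W → ℂ) (g : V → MvPolynomial W ℂ) (p : MvPolynomial V ℂ) :
    MvPolynomial.eval ω (MvPolynomial.bind₁ g p)
      = MvPolynomial.eval (fun k => MvPolynomial.eval ω (g k)) p := by
  rw [← MvPolynomial.coe_aeval_eq_eval, RingHom.coe_coe, MvPolynomial.aeval_bind₁,
    ← MvPolynomial.coe_aeval_eq_eval, RingHom.coe_coe]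

/-- The polar hyperplanes of the coefficients of `stringSum`. -/
def stringPoles (q : ℂ) (V : Type*) : Set (Option V × Option V × ℂ) :=
  {k | ∃ u w : V, u ≠ w ∧ ∃ d : ℕ, k = (some w, some u, q ^ d)}

theorem hasLinearDenominators_stringFactor {q : ℂ} (hq0 : q ≠ 0)
    (hq : ∀ k : ℕ, 1 ≤ k → q ^ k ≠ 1) (ν : Fin n ⊕ Fin m → ℕ) (u w : Fin n ⊕ Fin m) {b : ℕ}
    (hb : b < ν u) :
    HasLinearDenominators (stringPoles q (Fin n ⊕ Fin m)) fun ω =>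
      stringFactor q (ω none) ν (ω ∘ some) (q ^ b * (ω ∘ some) u) w := by
  by_cases h : w.isRight ∧ ν w ≠ 0
  · exact .of_eval 1 (Eventually.of_forall fun ω => by simp [stringFactor, h])
  simp only [stringFactor, if_neg h, Function.comp_apply]
  by_cases huw : u = w
  · subst huw
    rcases u with i | j
    · have hne : q ^ ν (.inl i) - q ^ b ≠ 0 := sub_ne_zero.2 (pow_ne_pow hq0 hq hb)
      refine .of_eval (.C (q ^ ν (.inl i) - q ^ b)⁻¹ * (1 - .X none * .C (q ^ b))) ?_
      filter_upwards [eventually_coord_ne (some (Sum.inl i)) 0] with ω hω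
      simp only [numFactor, map_mul, map_sub, map_one, MvPolynomial.eval_C, MvPolynomial.eval_X]
      rw [← sub_mul]
      field_simp
    · exact absurd ⟨rfl, by omega⟩ h
  · simp only [div_eq_mul_inv]
    refine .mul ?_ ?_
    · rcases w with i | j
      · exact .of_eval (.X (some (.inl i)) - .X none * (.C (q ^ b) * .X (some u)))
          (Eventually.of_forall fun ω => by simp [numFactor])
      · exact .of_eval (.C q * .X (some (.inr j)) - .C (q ^ b) * .X (some u))
          (Eventually.of_forall fun ω => by simp [numFactor])
    · rcases le_or_gt (ν w) b with hle | hlt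
      · have h1 : HasLinearDenominators (stringPoles q (Fin n ⊕ Fin m)) fun ω : _ → ℂ =>
            (q ^ ν w)⁻¹ * (ω (some w) - q ^ (b - ν w) * ω (some u))⁻¹ :=
          .mul (.of_eval (.C (q ^ ν w)⁻¹) (by simp))
            (.inv_form ⟨u, w, huw, _, rfl⟩ (by simpa using huw))
        refine h1.congr (Eventually.of_forall fun ω => ?_)
        rw [← mul_inv, mul_sub, ← mul_assoc, ← pow_add, Nat.add_sub_cancel' hle]
      · have h1 : HasLinearDenominators (stringPoles q (Fin n ⊕ Fin m)) fun ω : _ → ℂ =>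
            (-q ^ b)⁻¹ * (ω (some u) - q ^ (ν w - b) * ω (some w))⁻¹ :=
          .mul (.of_eval (.C (-q ^ b)⁻¹) (by simp))
            (.inv_form ⟨w, u, Ne.symm huw, _, rfl⟩ (by simpa using Ne.symm huw))
        refine h1.congr (Eventually.of_forall fun ω => ?_)
        rw [← mul_inv, mul_sub, ← mul_assoc, neg_mul, neg_mul, ← pow_add,
          Nat.add_sub_cancel' hlt.le]
        ring

theorem hasLinearDenominators_stringSum {q : ℂ} (hq0 : q ≠ 0)
    (hq : ∀ k : ℕ, 1 ≤ k → q ^ k ≠ 1) (t : ℂ) (p : MvPolynomial (Fin n ⊕ Fin m) ℂ) (s : ℕ) :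
    HasLinearDenominators (stringPoles q (Fin n ⊕ Fin m)) fun ω =>
      stringSum q t p s (ω none) (ω ∘ some) := by
  refine .sum _ _ fun ν _ => .mul ?_ ?_
  · exact .prod _ _ fun u _ => .prod _ _ fun b hb => .prod _ _ fun w _ =>
      hasLinearDenominators_stringFactor hq0 hq ν u w (Finset.mem_range.1 hb)
  · refine .of_eval (MvPolynomial.bind₁ (fun k =>
      .C (Sum.elim (fun _ => q) (fun _ => t⁻¹) k ^ ν k) * .X (some k)) p)
      (Eventually.of_forall fun ω => ?_)
    rw [eval_bind₁]
    congr 2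
    funext k
    simp [stringShift]

theorem exists_eval_eq_stringSum {q t : ℂ} (hq0 : q ≠ 0) (hq : ∀ k : ℕ, 1 ≤ k → q ^ k ≠ 1)
    {p : MvPolynomial (Fin n ⊕ Fin m) ℂ} (hp : memLambda n m q t p) (s : ℕ) :
    ∃ P : MvPolynomial (Option (Fin n ⊕ Fin m)) ℂ, ∀ᶠ ω in zariski _,
      MvPolynomial.eval ω P = stringSum q t p s (ω none) (ω ∘ some) := by
  refine (hasLinearDenominators_stringSum hq0 hq t p s).exists_eval_eq ?_
  rintro _ ⟨u, w, huw, d, rfl⟩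
  refine ⟨by simpa using huw, ?_⟩
  filter_upwards [eventually_inGeneralPosition hq0 (d + s) (Option.some_injective _),
    eventually_eventually_update
      (eventually_inGeneralPosition hq0 s (Option.some_injective (Fin n ⊕ Fin m)))] with ω h1 h2
  refine (tendsto_mul_sum_stringCoef hq0 hq (ω none) hp huw d s h1).congr' ?_
  have hshift : Tendsto (fun x : ℂ => q ^ d * ω (some u) + x) (𝓝[≠] 0)
      (𝓝[≠] (q ^ d * ω (some u))) := by
    refine tendsto_nhdsWithin_iff.2 ⟨?_, ?_⟩
    · have : Continuous (fun x : ℂ => q ^ d * ω (some u) + x) := by fun_prop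
      simpa using (this.tendsto 0).mono_left (nhdsWithin_le_nhds (s := {0}ᶜ))
    · filter_upwards [self_mem_nhdsWithin] with x hx
      simpa using hx
  filter_upwards [hshift.eventually (h2 (some w) (q ^ d * ω (some u)))] with x hx
  rw [stringSum_eq_sum_stringCoef hq0 hq t p _ hx, Function.update_of_ne (by simp),
    Function.update_comp_eq_of_injective _ (Option.some_injective _)]
  rfl

theorem continuousAt_eval_stringShift (q t : ℂ) (p : MvPolynomial (Fin n ⊕ Fin m) ℂ)
    (ν : Fin n ⊕ Fin m → ℕ) {X : Type*} [TopologicalSpace X] {v : X → Fin n ⊕ Fin m → ℂ} {x : X}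
    (hv : ContinuousAt v x) :
    ContinuousAt (fun x => MvPolynomial.eval (stringShift q t ν (v x)) p) x :=
  ((MvPolynomial.continuous_eval p).tendsto _).comp
    (tendsto_pi_nhds.2 fun k => continuousAt_const.mul ((continuousAt_pi.1 hv) k))

theorem StringRegular.continuousAt_redCoef {q : ℂ} {s : ℕ} {ν : Fin n ⊕ Fin m → ℕ}
    (hν : ν ∈ stringIndex n m s) {X : Type*} [TopologicalSpace X] {z : X → ℂ}
    {v : X → Fin n ⊕ Fin m → ℂ} {x : X} (hz : ContinuousAt z x) (hv : ContinuousAt v x)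
    (h : StringRegular q s (v x)) : ContinuousAt (fun x => redCoef q (z x) ν (v x)) x := by
  have hv' : ∀ k, ContinuousAt (fun x => v x k) x := fun k => (continuousAt_pi.1 hv) k
  refine tendsto_finsetProd _ fun u _ => tendsto_finsetProd _ fun b hb =>
    tendsto_finsetProd _ fun w _ => ?_
  by_cases h1 : w.isRight ∧ ν w ≠ 0
  · simp only [stringFactor, if_pos h1]
    exact tendsto_const_nhds
  · simp only [stringFactor, if_neg h1]
    refine Tendsto.div ?_ ?_ (sub_ne_zero.2 (h ν hν u b (Finset.mem_range.1 hb) w h1))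
    · rcases w with i | j
      · exact (hv' _).sub (hz.mul (continuousAt_const.mul (hv' u)))
      · exact (continuousAt_const.mul (hv' _)).sub (continuousAt_const.mul (hv' u))
    · exact (continuousAt_const.mul (hv' _)).sub (continuousAt_const.mul (hv' u))

theorem StringRegular.continuousAt_stringSum {q : ℂ} (t : ℂ)
    (p : MvPolynomial (Fin n ⊕ Fin m) ℂ) {s : ℕ} {X : Type*} [TopologicalSpace X] {z : X → ℂ}
    {v : X → Fin n ⊕ Fin m → ℂ} {x : X} (hz : ContinuousAt z x) (hv : ContinuousAt v x)
    (h : StringRegular q s (v x)) : ContinuousAt (fun x => stringSum q t p s (z x) (v x)) x :=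
  tendsto_finsetSum _ fun ν hν =>
    (h.continuousAt_redCoef hν hz hv).mul (continuousAt_eval_stringShift q t p ν hv)

theorem StringRegular.eval_eq_stringSum {q t : ℂ} {p : MvPolynomial (Fin n ⊕ Fin m) ℂ} {s : ℕ}
    {P : MvPolynomial (Option (Fin n ⊕ Fin m)) ℂ}
    (hP : ∀ᶠ ω in zariski _, MvPolynomial.eval ω P = stringSum q t p s (ω none) (ω ∘ some))
    {v : Fin n ⊕ Fin m → ℂ} (h : StringRegular q s v) (z : ℂ) :
    MvPolynomial.eval (fun k => k.elim z v) P = stringSum q t p s z v :=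
  eval_eq_of_eventually_zariski hP (v₀ := fun k => k.elim z v)
    (StringRegular.continuousAt_stringSum t p (continuous_apply none).continuousAt
      (continuous_pi fun k => continuous_apply (some k)).continuousAt h)

theorem InGeneralPosition.stringRegular {q : ℂ} (hq0 : q ≠ 0) (hq : ∀ k : ℕ, 1 ≤ k → q ^ k ≠ 1)
    {s : ℕ} {v : Fin n ⊕ Fin m → ℂ} (hv : InGeneralPosition q s v) : StringRegular q s v :=
  fun _ hν u _ hb w _ => hv.mul_ne_mul hq0 hq (le_of_mem_stringIndex hν w)
    (hb.le.trans (le_of_mem_stringIndex hν u)) (by rintro rfl; exact hb)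

end StringSum

section Symmetry

variable {n m : ℕ}

theorem redCoef_comp_sumCongr (q z : ℂ) (σ : Equiv.Perm (Fin n)) (τ : Equiv.Perm (Fin m))
    (ν : Fin n ⊕ Fin m → ℕ) (v : Fin n ⊕ Fin m → ℂ) :
    redCoef q z (ν ∘ Equiv.sumCongr σ τ) (v ∘ Equiv.sumCongr σ τ) = redCoef q z ν v := by
  have h : ∀ a w, stringFactor q z (ν ∘ Equiv.sumCongr σ τ) (v ∘ Equiv.sumCongr σ τ) a w
      = stringFactor q z ν v a (Equiv.sumCongr σ τ w) := by
    rintro a (i | j) <;> rfl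
  simp only [redCoef, h]
  refine Eq.trans ?_ (Equiv.prod_comp (Equiv.sumCongr σ τ) _)
  refine Finset.prod_congr rfl fun u _ => Finset.prod_congr rfl fun b _ => ?_
  exact Equiv.prod_comp (Equiv.sumCongr σ τ) (stringFactor q z ν v _)

theorem stringSum_comp_sumCongr {q t : ℂ} {p : MvPolynomial (Fin n ⊕ Fin m) ℂ}
    (hp : memLambda n m q t p) (s : ℕ) (z : ℂ) (σ : Equiv.Perm (Fin n)) (τ : Equiv.Perm (Fin m))
    (v : Fin n ⊕ Fin m → ℂ) :
    stringSum q t p s z (v ∘ Equiv.sumCongr σ τ) = stringSum q t p s z v := by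
  refine (Finset.sum_equiv ((Equiv.sumCongr σ τ).symm.arrowCongr (Equiv.refl ℕ)) ?_ ?_).symm
  · intro ν
    have h1 : ((Equiv.sumCongr σ τ).symm.arrowCongr (Equiv.refl ℕ)) ν
        = ν ∘ Equiv.sumCongr σ τ := by
      funext k
      simp
    rw [h1, mem_stringIndex, mem_stringIndex]
    refine and_congr ?_ ?_
    · rw [← Equiv.sum_comp (Equiv.sumCongr σ τ)]
      rfl
    · exact ⟨fun h j => h _, fun h j => by simpa using h (τ.symm j)⟩
  · intro ν _
    have h1 : ((Equiv.sumCongr σ τ).symm.arrowCongr (Equiv.refl ℕ)) ν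
        = ν ∘ Equiv.sumCongr σ τ := by
      funext k
      simp
    rw [h1, redCoef_comp_sumCongr, ← hp.eval_comp_sumMap σ τ (stringShift q t ν v)]
    congr 3
    funext k
    cases k <;> rfl

end Symmetry

section Merge

open Filter Topology

variable {n m : ℕ} (i : Fin n) (j : Fin m)

/-- The first element of the string of `x_i` is moved to `y_j`. -/
def mergeString (ν : Fin n ⊕ Fin m → ℕ) : Fin n ⊕ Fin m → ℕ :=
  if ν (.inl i) = 0 then ν
  else Function.update (Function.update ν (.inl i) (ν (.inl i) - 1)) (.inr j) 1

variable {i j}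

theorem mergeString_of_eq_zero {ν : Fin n ⊕ Fin m → ℕ} (h : ν (.inl i) = 0) :
    mergeString i j ν = ν := if_pos h

theorem mergeString_inl {ν : Fin n ⊕ Fin m → ℕ} :
    mergeString i j ν (.inl i) = ν (.inl i) - 1 := by
  rw [mergeString]
  split_ifs with h
  · omega
  · simp

theorem mergeString_inr {ν : Fin n ⊕ Fin m → ℕ} (h : ν (.inl i) ≠ 0) :
    mergeString i j ν (.inr j) = 1 := by
  simp [mergeString, h]

theorem mergeString_of_ne {ν : Fin n ⊕ Fin m → ℕ} {k : Fin n ⊕ Fin m} (hi : k ≠ .inl i)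
    (hj : k ≠ .inr j) : mergeString i j ν k = ν k := by
  rw [mergeString]
  split_ifs with h
  · rfl
  · simp [hi, hj]

theorem sum_mergeString {ν : Fin n ⊕ Fin m → ℕ} (h : ν (.inr j) = 0) :
    ∑ k, mergeString i j ν k = ∑ k, ν k := by
  have key := prod_univ_eq_pair_mul (M := Multiplicative ℕ)
    (show (Sum.inl i : Fin n ⊕ Fin m) ≠ .inr j by simp)
  have h1 : ∀ f : Fin n ⊕ Fin m → ℕ, ∑ k, f k = f (.inl i) + f (.inr j)
      + ∑ k ∈ (Finset.univ.erase (Sum.inl i)).erase (Sum.inr j), f k := fun f => key f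
  by_cases h0 : ν (.inl i) = 0
  · rw [mergeString_of_eq_zero h0]
  rw [h1, h1, mergeString_inl, mergeString_inr h0, Finset.sum_congr rfl fun k hk =>
    mergeString_of_ne (i := i) (j := j) (ν := ν) (by simp_all) (by simp_all)]
  omega

theorem mergeString_mem_stringIndex {s : ℕ} {ν : Fin n ⊕ Fin m → ℕ} (hν : ν ∈ stringIndex n m s)
    (h : ν (.inr j) = 0) : mergeString i j ν ∈ stringIndex n m s := by
  rw [mem_stringIndex] at hν ⊢
  refine ⟨(sum_mergeString h).trans hν.1, fun l => ?_⟩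
  rw [mergeString]
  split_ifs with h0
  · exact hν.2 l
  · by_cases hl : l = j
    · subst hl
      simp
    · simpa [hl] using hν.2 l

theorem redCoef_mergeString {q z ζ : ℂ} {s : ℕ} {ν : Fin n ⊕ Fin m → ℕ}
    (hν : ν ∈ stringIndex n m s) (hj : ν (.inr j) = 0) {a b : Fin n ⊕ Fin m → ℂ}
    (hai : a (.inl i) = z * ζ) (haj : a (.inr j) = ζ) (hbi : b (.inl i) = q * (z * ζ))
    (hbj : b (.inr j) = z * ζ) (hab : ∀ k, k ≠ .inl i → k ≠ .inr j → a k = b k)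
    (ha : InGeneralPosition q (s + 1) a) :
    redCoef q z ν a = redCoef q z (mergeString i j ν) b := by
  have hij : (Sum.inl i : Fin n ⊕ Fin m) ≠ .inr j := by simp
  have hstr : ∀ Ψ : ℂ → ℂ, ∏ u, ∏ e ∈ Finset.range (mergeString i j ν u), Ψ (q ^ e * b u)
      = ∏ u, ∏ e ∈ Finset.range (ν u), Ψ (q ^ e * a u) := by
    intro Ψ
    rw [prod_univ_eq_pair_mul hij, prod_univ_eq_pair_mul hij]
    congr 1
    · by_cases h0 : ν (.inl i) = 0
      · simp [mergeString_of_eq_zero h0, h0, hj]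
      · obtain ⟨c, hc⟩ := Nat.exists_eq_succ_of_ne_zero h0
        rw [mergeString_inl, mergeString_inr h0, hj, hc, Nat.succ_eq_add_one,
          Nat.add_sub_cancel, Finset.prod_range_succ' _ c, hai, hbi, hbj]
        simp [pow_succ, mul_assoc]
    · refine Finset.prod_congr rfl fun k hk => ?_
      have hki : k ≠ .inl i := by simp_all
      have hkj : k ≠ .inr j := by simp_all
      rw [mergeString_of_ne hki hkj, hab k hki hkj]
  rw [redCoef, redCoef, hstr fun σ => ∏ w, stringFactor q z (mergeString i j ν) b σ w]
  refine Finset.prod_congr rfl fun u _ => Finset.prod_congr rfl fun e he => ?_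
  have he' := Finset.mem_range.1 he
  have hes : e ≤ s := he'.le.trans (le_of_mem_stringIndex hν u)
  set σ := q ^ e * a u with hσ
  have hζ : ζ - σ ≠ 0 := by
    have huj : u ≠ .inr j := by
      rintro rfl
      omega
    have h1 := ha.2 u (.inr j) huj 0 (by omega) e (by omega)
    rw [pow_zero, one_mul, haj] at h1
    exact sub_ne_zero.2 h1
  rw [prod_univ_eq_pair_mul hij, prod_univ_eq_pair_mul hij]
  congr 1
  · by_cases h0 : ν (.inl i) = 0
    · have hσ' : q * (z * ζ) - σ ≠ 0 := by
        have hui : u ≠ .inl i := by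
          rintro rfl
          omega
        have h1 := ha.2 u (.inl i) hui 1 (by omega) e (by omega)
        rw [pow_one, hai] at h1
        exact sub_ne_zero.2 h1
      simp only [mergeString_of_eq_zero h0, stringFactor, h0, hj, numFactor, hai, haj, hbi, hbj,
        pow_zero, one_mul, Sum.isRight_inl, Sum.isRight_inr, ne_eq, not_true_eq_false, and_false,
        if_false, Bool.false_eq_true]
      rw [div_mul_div_comm, div_mul_div_comm, mul_comm (z * ζ - σ) (ζ - σ)]
      rw [show (z * ζ - z * σ) * (q * ζ - σ) = (ζ - σ) * (z * (q * ζ - σ)) by ring,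
        show (q * (z * ζ) - z * σ) * (q * (z * ζ) - σ)
          = (q * (z * ζ) - σ) * (z * (q * ζ - σ)) by ring,
        mul_div_mul_left _ _ hζ, mul_div_mul_left _ _ hσ']
    · obtain ⟨c, hc⟩ := Nat.exists_eq_succ_of_ne_zero h0
      simp only [stringFactor, mergeString_inl, mergeString_inr h0, hj, numFactor, hai, haj, hbi,
        hc, Sum.isRight_inl, Sum.isRight_inr, ne_eq, not_true_eq_false, and_false, and_true,
        false_and, if_false, Bool.false_eq_true, one_ne_zero, not_false_eq_true, if_true, mul_one,
        pow_zero, one_mul, Nat.succ_eq_add_one, Nat.add_sub_cancel]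
      rw [div_mul_div_comm, show (z * ζ - z * σ) * (q * ζ - σ) = z * (q * ζ - σ) * (ζ - σ) by ring,
        mul_div_mul_right _ _ hζ]
      ring
  · refine Finset.prod_congr rfl fun k hk => ?_
    have hki : k ≠ .inl i := by simp_all
    have hkj : k ≠ .inr j := by simp_all
    rw [stringFactor, stringFactor, mergeString_of_ne hki hkj, hab k hki hkj]

theorem stringSum_eq_sum_filter_inr (q t : ℂ) (p : MvPolynomial (Fin n ⊕ Fin m) ℂ) (s : ℕ) {z : ℂ}
    {a : Fin n ⊕ Fin m → ℂ} (h : a (.inl i) = z * a (.inr j)) :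
    stringSum q t p s z a = ∑ ν ∈ stringIndex n m s with ν (.inr j) = 0,
      redCoef q z ν a * MvPolynomial.eval (stringShift q t ν a) p := by
  refine (Finset.sum_filter_of_ne fun ν _ hne => ?_).symm
  by_contra h0
  refine hne (mul_eq_zero_of_left ?_ _)
  refine Finset.prod_eq_zero (Finset.mem_univ (Sum.inr j)) ?_
  refine Finset.prod_eq_zero (Finset.mem_range.2 (Nat.pos_of_ne_zero h0)) ?_
  refine Finset.prod_eq_zero (Finset.mem_univ (Sum.inl i)) ?_
  simp [stringFactor, numFactor, h]

theorem stringSum_eq_sum_filter_inl (q t : ℂ) (p : MvPolynomial (Fin n ⊕ Fin m) ℂ) (s : ℕ) (z : ℂ)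
    {a : Fin n ⊕ Fin m → ℂ} (h : a (.inl i) = q * a (.inr j)) :
    stringSum q t p s z a = ∑ ν ∈ stringIndex n m s with ν (.inr j) = 1 ∨ ν (.inl i) = 0,
      redCoef q z ν a * MvPolynomial.eval (stringShift q t ν a) p := by
  refine (Finset.sum_filter_of_ne fun ν hν hne => ?_).symm
  by_contra h0
  rw [not_or] at h0
  have h1 : ν (.inr j) = 0 := by
    have := (mem_stringIndex.1 hν).2 j
    omega
  refine hne (mul_eq_zero_of_left ?_ _)
  refine Finset.prod_eq_zero (Finset.mem_univ (Sum.inl i)) ?_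
  refine Finset.prod_eq_zero (Finset.mem_range.2 (Nat.pos_of_ne_zero h0.2)) ?_
  refine Finset.prod_eq_zero (Finset.mem_univ (Sum.inr j)) ?_
  simp [stringFactor, numFactor, h, h1]

theorem sum_filter_mergeString (s : ℕ) (f : (Fin n ⊕ Fin m → ℕ) → ℂ) :
    ∑ ν ∈ stringIndex n m s with ν (.inr j) = 0, f (mergeString i j ν)
      = ∑ ν ∈ stringIndex n m s with ν (.inr j) = 1 ∨ ν (.inl i) = 0, f ν := by
  refine Finset.sum_nbij (mergeString i j) ?_ ?_ ?_ fun _ _ => rfl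
  · intro ν hν
    rw [Finset.mem_filter] at hν ⊢
    refine ⟨mergeString_mem_stringIndex hν.1 hν.2, ?_⟩
    by_cases h : ν (.inl i) = 0
    · rw [mergeString_inl, h]
      exact Or.inr rfl
    · exact Or.inl (mergeString_inr h)
  · intro ν hν ν' hν' h
    rw [Finset.mem_coe, Finset.mem_filter] at hν hν'
    have hi := congrFun h (.inl i)
    rw [mergeString_inl, mergeString_inl] at hi
    have hj := congrFun h (.inr j)
    funext k
    by_cases hki : k = .inl i
    · subst hki
      by_cases h0 : ν (.inl i) = 0 <;> by_cases h1 : ν' (.inl i) = 0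
      · omega
      · rw [mergeString_of_eq_zero h0, mergeString_inr h1] at hj
        omega
      · rw [mergeString_of_eq_zero h1, mergeString_inr h0] at hj
        omega
      · omega
    · by_cases hkj : k = .inr j
      · subst hkj
        rw [hν.2, hν'.2]
      · simpa [mergeString_of_ne hki hkj] using congrFun h k
  · intro ν hν
    rw [Finset.mem_coe, Finset.mem_filter] at hν
    by_cases hj : ν (.inr j) = 1
    · have hm : mergeString i j (Function.update (Function.update ν (.inl i) (ν (.inl i) + 1))
          (.inr j) 0) = ν := by
        funext k
        by_cases hki : k = .inl i
        · subst hki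
          simp [mergeString_inl]
        · by_cases hkj : k = .inr j
          · subst hkj
            rw [mergeString_inr (by simp), hj]
          · simp [mergeString_of_ne hki hkj, hki, hkj]
      refine ⟨_, ?_, hm⟩
      rw [Finset.mem_coe, Finset.mem_filter, mem_stringIndex]
      refine ⟨⟨?_, fun l => ?_⟩, by simp⟩
      · rw [← sum_mergeString (i := i) (j := j) (by simp), hm]
        exact (mem_stringIndex.1 hν.1).1
      · by_cases hl : l = j
        · subst hl
          simp
        · simpa [hl] using (mem_stringIndex.1 hν.1).2 l
    · have h0 := hν.2.resolve_left hj
      refine ⟨ν, ?_, mergeString_of_eq_zero h0⟩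
      rw [Finset.mem_coe, Finset.mem_filter]
      refine ⟨hν.1, ?_⟩
      have := (mem_stringIndex.1 hν.1).2 j
      omega

theorem eval_stringShift_mergeString {q t ζ : ℂ} (ht0 : t ≠ 0)
    {p : MvPolynomial (Fin n ⊕ Fin m) ℂ} (hp : memLambda n m q t p) {ν : Fin n ⊕ Fin m → ℕ}
    (hj : ν (.inr j) = 0) {a b : Fin n ⊕ Fin m → ℂ}
    (hai : a (.inl i) = t * ζ) (haj : a (.inr j) = ζ) (hbi : b (.inl i) = q * (t * ζ))
    (hbj : b (.inr j) = t * ζ) (hab : ∀ k, k ≠ .inl i → k ≠ .inr j → a k = b k) :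
    MvPolynomial.eval (stringShift q t ν a) p
      = MvPolynomial.eval (stringShift q t (mergeString i j ν) b) p := by
  have hne : ∀ k, k ≠ .inl i → k ≠ .inr j →
      stringShift q t (mergeString i j ν) b k = stringShift q t ν a k := by
    intro k hki hkj
    rw [stringShift, stringShift, mergeString_of_ne hki hkj, hab k hki hkj]
  by_cases h0 : ν (.inl i) = 0
  · refine (hp.eval_eq_eval i j (t * ζ) ?_ ?_ ?_ ?_ hne).symm
    · simp [stringShift, mergeString_of_eq_zero h0, h0, hbi]
    · simp [stringShift, mergeString_of_eq_zero h0, hj, hbj]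
    · simp [stringShift, h0, hai]
    · simp [stringShift, hj, haj, ht0]
  · congr 2
    funext k
    by_cases hki : k = .inl i
    · subst hki
      obtain ⟨c, hc⟩ := Nat.exists_eq_succ_of_ne_zero h0
      simp only [stringShift, mergeString_inl, hc, hai, hbi, Nat.succ_eq_add_one,
        Nat.add_sub_cancel, Sum.elim_inl]
      ring
    · by_cases hkj : k = .inr j
      · subst hkj
        simp [stringShift, mergeString_inr h0, hj, haj, hbj, ht0]
      · exact (hne k hki hkj).symm

end Merge

section Preservation

open Filter Topology

variable {n m : ℕ}

theorem eventually_stringRegular_merge {q t : ℂ} (hq0 : q ≠ 0)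
    (hq : ∀ k : ℕ, 1 ≤ k → q ^ k ≠ 1) (ht0 : t ≠ 0) (s : ℕ) (i : Fin n) (j : Fin m) :
    ∀ᶠ v in zariski (Fin n ⊕ Fin m), StringRegular q s
      (Function.update (Function.update v (.inl i) (q * (t * v (.inr j)))) (.inr j)
        (t * v (.inr j))) := by
  have hgen : ∀ᶠ v : Fin n ⊕ Fin m → ℂ in zariski _, ∀ k, k ≠ .inr j →
      ∀ e ∈ Set.Iic (s + 1), ∀ l ∈ Set.Iic (s + 1), q ^ e * (t * v (.inr j)) ≠ q ^ l * v k := by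
    refine eventually_all.2 fun k => ?_
    by_cases hk : k = .inr j
    · simp [hk]
    have h1 : ∀ e ∈ Set.Iic (s + 1), ∀ᶠ v : Fin n ⊕ Fin m → ℂ in zariski _,
        ∀ l ∈ Set.Iic (s + 1), q ^ e * (t * v (.inr j)) ≠ q ^ l * v k := fun e _ =>
      (eventually_all_finite (Set.finite_Iic _)).2 fun l _ => by
        simpa only [mul_assoc] using
          eventually_mul_ne_mul hk (mul_ne_zero (pow_ne_zero e hq0) ht0) (q ^ l)
    filter_upwards [(eventually_all_finite (Set.finite_Iic _)).2 h1] with v hv _ using hv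
  filter_upwards [hgen, eventually_inGeneralPosition hq0 s Function.injective_id]
    with v hv hgp ν hν u b hb w hw
  rw [Function.comp_id] at hgp
  set ζ := v (.inr j) with hζ
  set L := Function.update (Function.update v (.inl i) (q * (t * ζ))) (.inr j) (t * ζ) with hL
  set e : Fin n ⊕ Fin m → ℕ := Sum.elim (fun _ => 1) (fun _ => 0) with he
  have he1 : ∀ k, e k ≤ 1 := by
    rintro (k | k) <;> simp [he]
  have hLp : ∀ k, k = .inl i ∨ k = .inr j → L k = q ^ e k * (t * ζ) := by
    rintro k (rfl | rfl) <;> simp [hL, he]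
  have hLn : ∀ k, ¬(k = .inl i ∨ k = .inr j) → L k = v k := by
    intro k hk
    rw [not_or] at hk
    simp [hL, hk.1, hk.2]
  have htζ : t * ζ ≠ 0 := mul_ne_zero ht0 (hgp.1 _)
  have hus := le_of_mem_stringIndex hν u
  have hws := le_of_mem_stringIndex hν w
  have hbs : b < s := hb.trans_le hus
  have hu1 := he1 u
  have hw1 := he1 w
  by_cases hu : u = .inl i ∨ u = .inr j <;> by_cases hw' : w = .inl i ∨ w = .inr j
  · rw [hLp u hu, hLp w hw', ← mul_assoc (q ^ ν w), ← mul_assoc (q ^ b), ← pow_add, ← pow_add]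
    have hne : ν w + e w ≠ b + e u := by
      rcases hu with rfl | rfl <;> rcases hw' with rfl | rfl
      · omega
      · simp only [Sum.isRight_inr, true_and, ne_eq, not_not] at hw
        simp only [he, Sum.elim_inl, Sum.elim_inr]
        omega
      · have := (mem_stringIndex.1 hν).2 j
        simp only [he, Sum.elim_inl, Sum.elim_inr]
        omega
      · omega
    intro h
    have h1 := mul_right_cancel₀ htζ h
    rcases hne.lt_or_gt with h2 | h2
    · exact pow_ne_pow hq0 hq h2 h1.symm
    · exact pow_ne_pow hq0 hq h2 h1
  · rw [hLp u hu, hLn w hw', ← mul_assoc, ← pow_add]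
    exact (hv w (fun h => hw' (Or.inr h)) _ (Set.mem_Iic.2 (by omega)) _
      (Set.mem_Iic.2 (by omega))).symm
  · rw [hLn u hu, hLp w hw', ← mul_assoc, ← pow_add]
    exact hv u (fun h => hu (Or.inr h)) _ (Set.mem_Iic.2 (by omega)) _ (Set.mem_Iic.2 (by omega))
  · rw [hLn u hu, hLn w hw']
    exact hgp.mul_ne_mul hq0 hq hws hbs.le (by rintro rfl; exact hb)

theorem eventually_eval_merge {q t : ℂ} (hq0 : q ≠ 0) (hq : ∀ k : ℕ, 1 ≤ k → q ^ k ≠ 1)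
    (ht0 : t ≠ 0) {p : MvPolynomial (Fin n ⊕ Fin m) ℂ} (hp : memLambda n m q t p) {s : ℕ}
    {P : MvPolynomial (Option (Fin n ⊕ Fin m)) ℂ}
    (hP : ∀ᶠ ω in zariski _, MvPolynomial.eval ω P = stringSum q t p s (ω none) (ω ∘ some))
    (i : Fin n) (j : Fin m) :
    ∀ᶠ v in zariski (Fin n ⊕ Fin m),
      MvPolynomial.eval (fun k : Option _ => k.elim t
          (Function.update v (.inl i) (t * v (.inr j)))) P
        = MvPolynomial.eval (fun k : Option _ => k.elim t
          (Function.update (Function.update v (.inl i) (q * (t * v (.inr j)))) (.inr j)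
            (t * v (.inr j)))) P := by
  filter_upwards [eventually_stringRegular_merge hq0 hq ht0 s i j,
    eventually_coord_ne (.inr j) 0, eventually_eventually_update
      (eventually_inGeneralPosition hq0 (s + 1) (Function.injective_id (α := Fin n ⊕ Fin m)))]
    with v hL hζ hR
  simp only [Function.comp_id] at hR
  set ζ := v (.inr j)
  set R : ℂ → Fin n ⊕ Fin m → ℂ := fun z => Function.update v (.inl i) (z * ζ) with hRdef
  set L : ℂ → Fin n ⊕ Fin m → ℂ := fun z =>
    Function.update (Function.update v (.inl i) (q * (z * ζ))) (.inr j) (z * ζ) with hLdef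
  have hRc : Continuous R := continuous_const.update _ (by fun_prop)
  have hzc : Continuous fun z : ℂ => z * ζ := by fun_prop
  have hLc : Continuous L :=
    (continuous_const.update _ (continuous_const.mul hzc)).update _ hzc
  have hRi : ∀ z, R z (.inl i) = z * ζ := by simp [hRdef]
  have hRj : ∀ z, R z (.inr j) = ζ := by simp [hRdef, ζ]
  have hLi : ∀ z, L z (.inl i) = q * (z * ζ) := by simp [hLdef]
  have hLj : ∀ z, L z (.inr j) = z * ζ := by simp [hLdef]
  have hRL : ∀ z k, k ≠ .inl i → k ≠ .inr j → R z k = L z k := by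
    intro z k hi hj
    simp [hRdef, hLdef, hi, hj]
  have hmaps : Tendsto (fun z : ℂ => z * ζ) (𝓝[≠] t) (𝓝[≠] (t * ζ)) := by
    refine tendsto_nhdsWithin_iff.2 ⟨?_, ?_⟩
    · have : Continuous (fun z : ℂ => z * ζ) := by fun_prop
      exact (this.tendsto t).mono_left nhdsWithin_le_nhds
    · filter_upwards [self_mem_nhdsWithin] with z hz h
      exact hz (mul_right_cancel₀ hζ h)
  have hR' : ∀ᶠ z in 𝓝[≠] t, InGeneralPosition q (s + 1) (R z) :=
    hmaps.eventually (hR (.inl i) (t * ζ))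
  have h1 : ∀ᶠ z in 𝓝[≠] t, MvPolynomial.eval (fun k : Option _ => k.elim z (R z)) P
      = ∑ ν ∈ stringIndex n m s with ν (.inr j) = 0, redCoef q z (mergeString i j ν) (L z)
        * MvPolynomial.eval (stringShift q t ν (R z)) p := by
    filter_upwards [hR'] with z hz
    have hz' : InGeneralPosition q s (R z) :=
      ⟨hz.1, fun u w huw k hk l hl => hz.2 u w huw k (by omega) l (by omega)⟩
    rw [(hz'.stringRegular hq0 hq).eval_eq_stringSum hP,
      stringSum_eq_sum_filter_inr q t p s (i := i) (j := j) (by rw [hRi, hRj])]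
    refine Finset.sum_congr rfl fun ν hν => ?_
    rw [Finset.mem_filter] at hν
    rw [redCoef_mergeString hν.1 hν.2 (hRi z) (hRj z) (hLi z) (hLj z) (hRL z) hz]
  have h2 : Tendsto (fun z => MvPolynomial.eval (fun k : Option _ => k.elim z (R z)) P)
      (𝓝[≠] t) (𝓝 (MvPolynomial.eval (fun k : Option _ => k.elim t (R t)) P)) := by
    have hc : Continuous fun z => MvPolynomial.eval (fun k : Option _ => k.elim z (R z)) P := by
      refine (MvPolynomial.continuous_eval P).comp (continuous_pi fun k => ?_)
      rcases k with _ | k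
      · exact continuous_id
      · exact (continuous_apply k).comp hRc
    exact (hc.tendsto t).mono_left nhdsWithin_le_nhds
  have h3 : Tendsto (fun z => ∑ ν ∈ stringIndex n m s with ν (.inr j) = 0,
      redCoef q z (mergeString i j ν) (L z) * MvPolynomial.eval (stringShift q t ν (R z)) p)
      (𝓝[≠] t) (𝓝 (∑ ν ∈ stringIndex n m s with ν (.inr j) = 0,
      redCoef q t (mergeString i j ν) (L t)
        * MvPolynomial.eval (stringShift q t ν (R t)) p)) := by
    refine Tendsto.mono_left (tendsto_finsetSum _ fun ν hν => ?_) nhdsWithin_le_nhds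
    rw [Finset.mem_filter] at hν
    exact (StringRegular.continuousAt_redCoef (mergeString_mem_stringIndex hν.1 hν.2)
      continuousAt_id hLc.continuousAt hL).mul
      (continuousAt_eval_stringShift q t p ν hRc.continuousAt)
  have h4 := tendsto_nhds_unique (h2.congr' h1) h3
  refine h4.trans ?_
  rw [show Function.update (Function.update v (.inl i) (q * (t * ζ))) (.inr j) (t * ζ) = L t
    from rfl] at hL ⊢
  rw [hL.eval_eq_stringSum hP,
    stringSum_eq_sum_filter_inl q t p s t (i := i) (j := j) (by rw [hLi, hLj]),
    ← sum_filter_mergeString]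
  refine Finset.sum_congr rfl fun ν hν => ?_
  rw [Finset.mem_filter] at hν
  rw [eval_stringShift_mergeString ht0 hp hν.2 (hRi t) (hRj t) (hLi t) (hLj t) (hRL t)]

theorem exists_memLambda_eval_eq_stringSum {q t : ℂ} (hq0 : q ≠ 0)
    (hq : ∀ k : ℕ, 1 ≤ k → q ^ k ≠ 1) (ht0 : t ≠ 0) {p : MvPolynomial (Fin n ⊕ Fin m) ℂ}
    (hp : memLambda n m q t p) (s : ℕ) :
    ∃ Q : MvPolynomial (Fin n ⊕ Fin m) ℂ, memLambda n m q t Q ∧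
      ∀ v, StringRegular q s v → MvPolynomial.eval v Q = stringSum q t p s t v := by
  obtain ⟨P, hP⟩ := exists_eval_eq_stringSum hq0 hq hp s
  set Q : MvPolynomial (Fin n ⊕ Fin m) ℂ :=
    MvPolynomial.bind₁ (fun k : Option _ => k.elim (.C t) .X) P with hQdef
  have hQ : ∀ v, MvPolynomial.eval v Q = MvPolynomial.eval (fun k : Option _ => k.elim t v) P := by
    intro v
    rw [hQdef, eval_bind₁]
    congr 2
    funext k
    cases k <;> simp
  have hreg : ∀ v, StringRegular q s v → MvPolynomial.eval v Q = stringSum q t p s t v :=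
    fun v hv => (hQ v).trans (hv.eval_eq_stringSum hP t)
  refine ⟨Q, ⟨fun σ τ x y => ?_, fun i j x y hxy => ?_⟩, hreg⟩
  · have hrename : MvPolynomial.rename (Equiv.sumCongr σ τ) Q = Q := by
      apply eq_of_eventually_eval_eq
      filter_upwards [eventually_inGeneralPosition hq0 s (Equiv.sumCongr σ τ).injective,
        eventually_inGeneralPosition hq0 s Function.injective_id] with v h1 h2
      rw [Function.comp_id] at h2
      rw [MvPolynomial.eval_rename, hreg _ (h1.stringRegular hq0 hq),
        hreg _ (h2.stringRegular hq0 hq), stringSum_comp_sumCongr hp]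
    have h := congrArg (MvPolynomial.eval (Sum.elim x y)) hrename
    rw [MvPolynomial.eval_rename] at h
    rw [evalXY, evalXY, ← h]
    congr 2
    funext k
    cases k <;> rfl
  · set g : Fin n ⊕ Fin m → MvPolynomial (Fin n ⊕ Fin m) ℂ :=
      Function.update .X (.inl i) (.C t * .X (.inr j)) with hg
    set g' : Fin n ⊕ Fin m → MvPolynomial (Fin n ⊕ Fin m) ℂ :=
      Function.update (Function.update .X (.inl i) (.C q * (.C t * .X (.inr j)))) (.inr j)
        (.C t * .X (.inr j)) with hg'
    have hge : ∀ v : Fin n ⊕ Fin m → ℂ, (fun k => MvPolynomial.eval v (g k))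
        = Function.update v (.inl i) (t * v (.inr j)) := by
      intro v
      funext k
      by_cases hi : k = .inl i
      · subst hi
        simp [hg]
      · simp [hg, hi]
    have hge' : ∀ v : Fin n ⊕ Fin m → ℂ, (fun k => MvPolynomial.eval v (g' k))
        = Function.update (Function.update v (.inl i) (q * (t * v (.inr j)))) (.inr j)
          (t * v (.inr j)) := by
      intro v
      funext k
      by_cases hj : k = .inr j
      · subst hj
        simp [hg']
      · by_cases hi : k = .inl i
        · subst hi
          simp [hg']
        · simp [hg', hi, hj]
    have hbind : MvPolynomial.bind₁ g Q = MvPolynomial.bind₁ g' Q := by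
      apply eq_of_eventually_eval_eq
      filter_upwards [eventually_eval_merge hq0 hq ht0 hp hP i j] with v hv
      rw [eval_bind₁ v g, eval_bind₁ v g', hge, hge', hQ, hQ, hv]
    have h := congrArg (MvPolynomial.eval (Sum.elim x (Function.update y j (t⁻¹ * y j)))) hbind
    rw [eval_bind₁ _ g, eval_bind₁ _ g', hge, hge'] at h
    rw [evalXY, evalXY]
    have hj : t * Sum.elim x (Function.update y j (t⁻¹ * y j)) (.inr j) = y j := by
      simp [ht0]
    rw [hj] at h
    have h1 : Function.update x i (y j) = x := by
      rw [← hxy, Function.update_eq_self]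
    rw [← Sum.elim_update_left, ← Sum.elim_update_left, ← Sum.elim_update_right,
      Function.update_idem, Function.update_eq_self, h1] at h
    rw [h, hxy]

end Preservation

section NoumiSano

theorem prod_pair_identity {R : Type*} [CommRing R] (q α β : R) (M N : ℕ) :
    (q ^ M * α - q ^ N * β) * ((∏ b ∈ range M, (q ^ N * β - q ^ b * α))
        * ∏ b ∈ range N, (q ^ M * α - q ^ b * β))
      = q ^ (M * N) * (α - β) * ((∏ b ∈ range M, (β - q ^ (b + 1) * α))
        * ∏ b ∈ range N, (α - q ^ (b + 1) * β)) := by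
  induction N with
  | zero =>
    have h := (Finset.prod_range_succ (fun b => β - q ^ b * α) M).symm.trans
      (Finset.prod_range_succ' (fun b => β - q ^ b * α) M)
    simp only [pow_zero, one_mul, mul_zero, Finset.prod_range_zero, mul_one] at h ⊢
    linear_combination -h
  | succ N ih =>
    have h := (Finset.prod_range_succ (fun b => q ^ (N + 1) * β - q ^ b * α) M).symm.trans
      (Finset.prod_range_succ' (fun b => q ^ (N + 1) * β - q ^ b * α) M)
    have h' : ∏ b ∈ range M, (q ^ (N + 1) * β - q ^ (b + 1) * α)
        = q ^ M * ∏ b ∈ range M, (q ^ N * β - q ^ b * α) := by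
      rw [← Finset.card_range M, ← Finset.prod_const, Finset.card_range, ← Finset.prod_mul_distrib]
      exact Finset.prod_congr rfl fun b _ => by ring
    rw [h', pow_zero, one_mul] at h
    rw [Finset.prod_range_succ, Finset.prod_range_succ, mul_add, mul_one,
      pow_add q (M * N)]
    linear_combination
      (-(∏ b ∈ range N, (q ^ M * α - q ^ b * β)) * (q ^ M * α - q ^ N * β)) * h
        + q ^ M * (α - q ^ (N + 1) * β) * ih

theorem prod_range_pow_sub_pow {R : Type*} [CommRing R] (q : R) (M : ℕ) :
    ∏ b ∈ range M, (q ^ M - q ^ b)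
      = (-1) ^ M * q ^ M.choose 2 * ∏ b ∈ range M, (1 - q ^ (b + 1)) := by
  have h : ∀ b ∈ range M, q ^ M - q ^ b = -1 * q ^ b * (1 - q ^ (M - 1 - b + 1)) := by
    intro b hb
    have hb := Finset.mem_range.1 hb
    rw [mul_sub, mul_assoc _ _ (q ^ _), ← pow_add, show b + (M - 1 - b + 1) = M by omega]
    ring
  rw [Finset.prod_congr rfl h, Finset.prod_mul_distrib, Finset.prod_mul_distrib,
    Finset.prod_const, Finset.card_range, Finset.prod_pow_eq_pow_sum, Finset.sum_range_id,
    Nat.choose_two_right, Finset.prod_range_reflect (fun b => 1 - q ^ (b + 1))]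

theorem two_mul_choose_two_add_self (a : ℕ) : 2 * a.choose 2 + a = a * a := by
  rw [Nat.choose_two_right, Nat.mul_div_cancel' (Nat.even_mul_pred_self a).two_dvd]
  rcases a with _ | a
  · rfl
  · simp only [Nat.add_sub_cancel]
    ring

theorem sum_choose_two_add_sum_mul {ι : Type*} [Fintype ι] [LinearOrder ι]
    [LocallyFiniteOrderTop ι] [LocallyFiniteOrderBot ι] (μ : ι → ℕ) :
    ∑ i, (μ i).choose 2 + ∑ i, ∑ j ∈ Finset.Ioi i, μ i * μ j = (∑ i, μ i).choose 2 := by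
  have h1 := Finset.sum_sum_Ioi_add_eq_sum_sum_off_diag fun i j => μ i * μ j
  have h2 : ∑ i, ∑ j ∈ Finset.Ioi i, (μ j * μ i + μ i * μ j)
      = 2 * ∑ i, ∑ j ∈ Finset.Ioi i, μ i * μ j := by
    simp only [Finset.mul_sum]
    exact Finset.sum_congr rfl fun i _ => Finset.sum_congr rfl fun j _ => by ring
  have h3 : ∑ i, ∑ j ∈ {i}ᶜ, μ j * μ i + ∑ i, μ i * μ i = (∑ i, μ i) * ∑ i, μ i := by
    rw [← Finset.sum_add_distrib, Finset.mul_sum]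
    refine Finset.sum_congr rfl fun i _ => ?_
    rw [Finset.sum_mul, ← Finset.sum_compl_add_sum {i}, Finset.sum_singleton]
  have h4 : 2 * ∑ i, (μ i).choose 2 + ∑ i, μ i = ∑ i, μ i * μ i := by
    rw [Finset.mul_sum, ← Finset.sum_add_distrib]
    exact Finset.sum_congr rfl fun i _ => two_mul_choose_two_add_self _
  have h5 := two_mul_choose_two_add_self (∑ i, μ i)
  omega

theorem vand_qShift_mul_prod {n : ℕ} (q : ℂ) (μ : Fin n → ℕ) (x : Fin n → ℂ) :
    vand (qShift q μ x) * ∏ i, ∏ k, ∏ b ∈ range (μ i), (q ^ μ k * x k - q ^ b * x i)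
      = (-1) ^ (∑ i, μ i) * q ^ (∑ i, μ i).choose 2
        * (vand x * ∏ i, ∏ k, ∏ b ∈ range (μ i), (x k - q ^ (b + 1) * x i)) := by
  have hsplit : ∀ f : Fin n → Fin n → ℂ, ∏ i, ∏ k, f i k
      = (∏ i, f i i) * ∏ i, ∏ k ∈ Finset.Ioi i, f i k * f k i := by
    intro f
    have h := Finset.prod_prod_Ioi_mul_eq_prod_prod_off_diag fun i k => f k i
    rw [h, ← Finset.prod_mul_distrib]
    refine Finset.prod_congr rfl fun i _ => ?_
    rw [← Finset.prod_mul_prod_compl {i}, Finset.prod_singleton]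
  have hdiag : ∀ i, ∏ b ∈ range (μ i), (q ^ μ i * x i - q ^ b * x i)
      = (-1) ^ μ i * q ^ (μ i).choose 2 * ∏ b ∈ range (μ i), (x i - q ^ (b + 1) * x i) := by
    intro i
    have h1 : ∀ b ∈ range (μ i), q ^ μ i * x i - q ^ b * x i = (q ^ μ i - q ^ b) * x i :=
      fun b _ => by ring
    have h2 : ∀ b ∈ range (μ i), x i - q ^ (b + 1) * x i = (1 - q ^ (b + 1)) * x i :=
      fun b _ => by ring
    rw [Finset.prod_congr rfl h1, Finset.prod_congr rfl h2, Finset.prod_mul_distrib,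
      Finset.prod_mul_distrib, prod_range_pow_sub_pow]
    ring
  rw [hsplit, hsplit, Finset.prod_congr rfl fun i _ => hdiag i, Finset.prod_mul_distrib,
    Finset.prod_mul_distrib, Finset.prod_pow_eq_pow_sum, Finset.prod_pow_eq_pow_sum,
    ← sum_choose_two_add_sum_mul, pow_add, vand, vand]
  have hpair : (∏ i, ∏ k ∈ Finset.Ioi i, (qShift q μ x i - qShift q μ x k))
      * ∏ i, ∏ k ∈ Finset.Ioi i, ((∏ b ∈ range (μ i), (q ^ μ k * x k - q ^ b * x i))
        * ∏ b ∈ range (μ k), (q ^ μ i * x i - q ^ b * x k))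
      = q ^ (∑ i, ∑ k ∈ Finset.Ioi i, μ i * μ k) * (∏ i, ∏ k ∈ Finset.Ioi i, (x i - x k))
      * ∏ i, ∏ k ∈ Finset.Ioi i, ((∏ b ∈ range (μ i), (x k - q ^ (b + 1) * x i))
        * ∏ b ∈ range (μ k), (x i - q ^ (b + 1) * x k)) := by
    rw [← Finset.prod_pow_eq_pow_sum]
    simp only [← Finset.prod_pow_eq_pow_sum, ← Finset.prod_mul_distrib]
    exact Finset.prod_congr rfl fun i _ => Finset.prod_congr rfl fun k _ =>
      prod_pair_identity q (x i) (x k) (μ i) (μ k)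
  linear_combination ((-1) ^ (∑ i, μ i) * q ^ (∑ i, (μ i).choose 2)
    * ∏ i, ∏ b ∈ range (μ i), (x i - q ^ (b + 1) * x i)) * hpair

theorem prod_range_telescope {q x y : ℂ} {M : ℕ} (hq0 : q ≠ 0) (h0 : q * y ≠ x)
    (h : ∀ b < M, y ≠ q ^ b * x) :
    ∏ b ∈ range M, (q * y - q ^ b * x) / (y - q ^ b * x)
      = q ^ M * ((q * y - x) / (q * y - q ^ M * x)) := by
  induction M with
  | zero => simp [div_self (sub_ne_zero.2 h0)]
  | succ M ih =>
    have h1 : q * y - q ^ M * x ≠ 0 := by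
      rcases M with _ | M
      · simpa using sub_ne_zero.2 h0
      · rw [pow_succ', mul_assoc, ← mul_sub]
        exact mul_ne_zero hq0 (sub_ne_zero.2 (h M (by omega)))
    have h2 : y - q ^ M * x ≠ 0 := sub_ne_zero.2 (h M (by omega))
    rw [Finset.prod_range_succ, ih fun b hb => h b (by omega),
      show q * y - q ^ (M + 1) * x = q * (y - q ^ M * x) by ring]
    field_simp
    rw [pow_succ]

variable {n m : ℕ}

/-- The lengths of strings attached to the shift by `q ^ μ i` of `x i` and by `t⁻¹` of `y j` for
`j ∈ I`. -/
def stringLengths (μ : Fin n → ℕ) (I : Finset (Fin m)) : Fin n ⊕ Fin m → ℕ :=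
  Sum.elim μ fun j => if j ∈ I then 1 else 0

theorem sum_stringLengths (μ : Fin n → ℕ) (I : Finset (Fin m)) :
    ∑ k, stringLengths μ I k = ∑ i, μ i + I.card := by
  simp [stringLengths]

theorem stringLengths_mem_stringIndex {μ : Fin n → ℕ} {I : Finset (Fin m)} {s : ℕ} :
    stringLengths μ I ∈ stringIndex n m s ↔ ∑ i, μ i + I.card = s := by
  rw [mem_stringIndex, sum_stringLengths, and_iff_left]
  intro j
  simp only [stringLengths, Sum.elim_inr]
  split_ifs <;> simp

theorem stringLengths_eq_self {s : ℕ} {ν : Fin n ⊕ Fin m → ℕ} (hν : ν ∈ stringIndex n m s) :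
    stringLengths (ν ∘ Sum.inl) {j | ν (.inr j) ≠ 0} = ν := by
  funext k
  rcases k with k | k
  · rfl
  · have := (mem_stringIndex.1 hν).2 k
    simp only [stringLengths, Sum.elim_inr, Finset.mem_filter, Finset.mem_univ, true_and]
    split_ifs <;> omega

theorem sum_stringIndex (g : (Fin n ⊕ Fin m → ℕ) → ℂ) {r s : ℕ} (h : s ≤ r) :
    ∑ ν ∈ stringIndex n m s, g ν
      = ∑ μ ∈ Fintype.piFinset (fun _ : Fin n => Finset.range (r + 1)), ∑ I : Finset (Fin m),
        if ∑ i, μ i + I.card = s then g (stringLengths μ I) else 0 := by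
  rw [← Finset.sum_product', ← Finset.sum_filter]
  symm
  refine Finset.sum_nbij' (fun a => stringLengths a.1 a.2)
    (fun ν => (ν ∘ Sum.inl, ({j | ν (.inr j) ≠ 0} : Finset (Fin m)))) ?_ ?_ ?_ ?_ ?_
  · rintro ⟨μ, I⟩ ha
    exact stringLengths_mem_stringIndex.2 (Finset.mem_filter.1 ha).2
  · intro ν hν
    have h1 := hν
    rw [← stringLengths_eq_self hν, stringLengths_mem_stringIndex] at h1
    rw [Finset.mem_filter, Finset.mem_product, Fintype.mem_piFinset]
    refine ⟨⟨fun i => ?_, Finset.mem_univ _⟩, h1⟩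
    have := le_of_mem_stringIndex hν (.inl i)
    exact Finset.mem_range.2 (by simp only [Function.comp_apply]; omega)
  · rintro ⟨μ, I⟩ -
    refine Prod.ext ?_ ?_
    · rfl
    · ext j
      simp [stringLengths]
  · exact fun ν hν => stringLengths_eq_self hν
  · exact fun _ _ => rfl

theorem stringShift_stringLengths (q t : ℂ) (μ : Fin n → ℕ) (I : Finset (Fin m))
    (x : Fin n → ℂ) (y : Fin m → ℂ) :
    stringShift q t (stringLengths μ I) (Sum.elim x y)
      = Sum.elim (qShift q μ x) (tShiftI t I y) := by
  funext k
  rcases k with k | k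
  · rfl
  · simp only [stringShift, stringLengths, tShiftI, Sum.elim_inr]
    split_ifs <;> simp

theorem prod_stringFactor (q z σ : ℂ) (μ : Fin n → ℕ) (I : Finset (Fin m))
    (x : Fin n → ℂ) (y : Fin m → ℂ) :
    ∏ w, stringFactor q z (stringLengths μ I) (Sum.elim x y) σ w
      = (∏ k, (x k - z * σ) / (q ^ μ k * x k - σ)) * ∏ j ∈ Iᶜ, (q * y j - σ) / (y j - σ) := by
  rw [Fintype.prod_sum_type]
  congr 1
  rw [← Finset.prod_mul_prod_compl I, Finset.prod_eq_one, one_mul]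
  · refine Finset.prod_congr rfl fun j hj => ?_
    simp [stringFactor, stringLengths, numFactor, Finset.mem_compl.1 hj]
  · intro j hj
    simp [stringFactor, stringLengths, hj]

theorem redCoef_stringLengths (q z : ℂ) (μ : Fin n → ℕ) (I : Finset (Fin m))
    (x : Fin n → ℂ) (y : Fin m → ℂ) :
    redCoef q z (stringLengths μ I) (Sum.elim x y)
      = (∏ i, ∏ k, ∏ b ∈ range (μ i), (x k - z * (q ^ b * x i)) / (q ^ μ k * x k - q ^ b * x i))
        * (∏ i, ∏ j ∈ Iᶜ, ∏ b ∈ range (μ i), (q * y j - q ^ b * x i) / (y j - q ^ b * x i))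
        * ((∏ i, ∏ j ∈ I, (x i - z * y j) / (q ^ μ i * x i - y j))
        * ∏ j ∈ I, ∏ l ∈ Iᶜ, (q * y l - y j) / (y l - y j)) := by
  simp only [redCoef, prod_stringFactor]
  rw [Fintype.prod_sum_type]
  congr 1
  · rw [← Finset.prod_mul_distrib]
    refine Finset.prod_congr rfl fun i _ => ?_
    simp only [stringLengths, Sum.elim_inl]
    rw [Finset.prod_mul_distrib, Finset.prod_comm, Finset.prod_comm (s := range (μ i))]
  · rw [Finset.prod_comm (t := I), ← Finset.prod_mul_distrib, ← Finset.prod_mul_prod_compl I,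
      Finset.prod_eq_one (s := Iᶜ), mul_one]
    · refine Finset.prod_congr rfl fun j hj => ?_
      simp [stringLengths, hj]
    · intro j hj
      simp [stringLengths, Finset.mem_compl.1 hj]

end NoumiSano

section NoumiSanoCoefficients

variable {n m : ℕ} {q t : ℂ} {μ : Fin n → ℕ} {I : Finset (Fin m)} {x : Fin n → ℂ} {y : Fin m → ℂ}

theorem qPoch_div_eq (a c : ℂ) {z : ℂ} (hz : z ≠ 0) (q : ℂ) (k : ℕ) :
    qPoch (c * a / z) q k = ∏ b ∈ range k, (z - c * (q ^ b * a)) / z :=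
  Finset.prod_congr rfl fun b _ => by
    field_simp

theorem BcoefDen_ne_zero (h : BcoefDen n m q t μ I x y ≠ 0) :
    q ≠ 0 ∧ t ≠ 0 ∧ vand x ≠ 0 ∧ (∀ i, x i ≠ 0) ∧ (∀ j, y j ≠ 0)
      ∧ (∀ i k, ∀ b < μ i, x k - q ^ (b + 1) * x i ≠ 0)
      ∧ (∀ j ∈ I, ∀ l ∈ Iᶜ, y j - y l ≠ 0)
      ∧ (∀ i, ∀ j ∈ I, y j - q ^ μ i * x i ≠ 0)
      ∧ ∀ i, ∀ j ∈ Iᶜ, q * y j - q ^ μ i * x i ≠ 0 := by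
  simp only [BcoefDen, mul_ne_zero_iff, Finset.prod_ne_zero_iff, Finset.mem_univ,
    true_implies] at h
  obtain ⟨⟨⟨⟨⟨⟨⟨hq, ht⟩, hV⟩, hx⟩, hy⟩, hP⟩, hyy⟩, hxy⟩ := h
  refine ⟨hq, ht, hV, hx, hy, fun i k b hb h0 => ?_, hyy, fun i j hj h0 => ?_,
    fun i j hj h0 => ?_⟩
  · have h1 := hP i k
    rw [qPoch_div_eq _ _ (hx k), Finset.prod_ne_zero_iff] at h1
    refine h1 b (Finset.mem_range.2 hb) ?_
    rw [← mul_assoc, ← pow_succ', h0, zero_div]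
  · have := (hxy i).1 j hj
    rw [← sub_eq_zero.1 h0, div_self (hy j), sub_self] at this
    exact this rfl
  · have := (hxy i).2 j hj
    refine this ?_
    rw [zpow_sub_one₀ hq, zpow_natCast, mul_right_comm, ← sub_eq_zero.1 h0]
    have := hy j
    field_simp
    ring

theorem prod_sub_ne_zero (h : BcoefDen n m q t μ I x y ≠ 0) :
    ∏ i, ∏ k, ∏ b ∈ range (μ i), (x k - q ^ (b + 1) * x i) ≠ 0
      ∧ ∏ i, ∏ k, ∏ b ∈ range (μ i), (q ^ μ k * x k - q ^ b * x i) ≠ 0 := by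
  obtain ⟨hq, ht, hV, hx, hy, hP, -⟩ := BcoefDen_ne_zero h
  have h2 : ∏ i, ∏ k, ∏ b ∈ range (μ i), (x k - q ^ (b + 1) * x i) ≠ 0 := by
    simp only [Finset.prod_ne_zero_iff]
    exact fun i _ k _ b hb => hP i k b (Finset.mem_range.1 hb)
  refine ⟨h2, right_ne_zero_of_mul (a := vand (qShift q μ x)) ?_⟩
  rw [vand_qShift_mul_prod]
  exact mul_ne_zero (mul_ne_zero (pow_ne_zero _ (by norm_num)) (pow_ne_zero _ hq))
    (mul_ne_zero hV h2)

theorem vand_qShift_div_mul_prod_qPoch (h : BcoefDen n m q t μ I x y ≠ 0) :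
    vand (qShift q μ x) / vand x
      * (∏ i, ∏ k, qPoch (t * x i / x k) q (μ i) / qPoch (q * x i / x k) q (μ i))
      = (-1) ^ (∑ i, μ i) * q ^ (∑ i, μ i).choose 2
        * ∏ i, ∏ k, ∏ b ∈ range (μ i),
          (x k - t * (q ^ b * x i)) / (q ^ μ k * x k - q ^ b * x i) := by
  obtain ⟨hq, ht, hV, hx, hy, hP, -⟩ := BcoefDen_ne_zero h
  obtain ⟨h2, h3⟩ := prod_sub_ne_zero h
  have h4 : ∀ i k, qPoch (t * x i / x k) q (μ i) / qPoch (q * x i / x k) q (μ i)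
      = (∏ b ∈ range (μ i), (x k - t * (q ^ b * x i)))
        / ∏ b ∈ range (μ i), (x k - q ^ (b + 1) * x i) := by
    intro i k
    rw [qPoch_div_eq _ _ (hx k), qPoch_div_eq _ _ (hx k), ← Finset.prod_div_distrib,
      ← Finset.prod_div_distrib]
    refine Finset.prod_congr rfl fun b _ => ?_
    rw [div_div_div_cancel_right₀ (hx k), pow_succ', mul_assoc]
  simp only [h4, Finset.prod_div_distrib]
  rw [div_mul_div_comm, mul_div_assoc', div_eq_div_iff (mul_ne_zero hV h2) h3]
  linear_combination (∏ i, ∏ k, ∏ b ∈ range (μ i), (x k - t * (q ^ b * x i))) * vand_qShift_mul_prod q μ x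

theorem Bcoef_eq_redCoef (h : BcoefDen n m q t μ I x y ≠ 0)
    (hy' : ∀ i, ∀ j ∈ Iᶜ, ∀ b < μ i, y j ≠ q ^ b * x i) (hy0 : ∀ i, ∀ j ∈ Iᶜ, q * y j ≠ x i) :
    (t ^ ((1 : ℤ) - n) * q ^ m) ^ (∑ i, μ i) * (-t) ^ I.card * q ^ (I.card * (I.card - 1) / 2)
        * Bcoef n m q t μ I x y
      = (-t ^ ((1 : ℤ) - n)) ^ (∑ i, μ i + I.card) * q ^ (∑ i, μ i + I.card).choose 2
        * redCoef q t (stringLengths μ I) (Sum.elim x y) := by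
  obtain ⟨hq, ht, hV, hx, hy, -, hyy, hI, hIc⟩ := BcoefDen_ne_zero h
  have h1 : ∏ j ∈ I, ∏ l ∈ Iᶜ, (y j - q * y l) / (y j - y l)
      = ∏ j ∈ I, ∏ l ∈ Iᶜ, (q * y l - y j) / (y l - y j) :=
    Finset.prod_congr rfl fun j _ => Finset.prod_congr rfl fun l _ => by
      rw [← neg_div_neg_eq, neg_sub, neg_sub]
  have h2 : ∏ i, ∏ j ∈ I, (1 - x i / (t * y j)) / (1 - q ^ μ i * x i / y j)
      = t⁻¹ ^ (n * I.card) * ∏ i, ∏ j ∈ I, (x i - t * y j) / (q ^ μ i * x i - y j) := by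
    have : ∀ i, ∀ j ∈ I, (1 - x i / (t * y j)) / (1 - q ^ μ i * x i / y j)
        = t⁻¹ * ((x i - t * y j) / (q ^ μ i * x i - y j)) := by
      intro i j hj
      have h3 := hI i j hj
      have h4 : q ^ μ i * x i - y j ≠ 0 := by
        rw [← neg_sub]
        exact neg_ne_zero.2 h3
      have h5 := hy j
      rw [show 1 - q ^ μ i * x i / y j = -(q ^ μ i * x i - y j) / y j by
        rw [neg_sub, sub_div, div_self h5]]
      field_simp
      ring
    rw [Finset.prod_congr rfl fun i _ => Finset.prod_congr rfl (this i)]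
    simp only [Finset.prod_mul_distrib, Finset.prod_const, Finset.card_univ, Fintype.card_fin]
    rw [← pow_mul, mul_comm n]
  have h3 : q ^ (Iᶜ.card * ∑ i, μ i)
      * ∏ i, ∏ j ∈ Iᶜ, (1 - x i / (q * y j)) / (1 - q ^ ((μ i : ℤ) - 1) * x i / y j)
      = ∏ i, ∏ j ∈ Iᶜ, ∏ b ∈ range (μ i), (q * y j - q ^ b * x i) / (y j - q ^ b * x i) := by
    have : ∀ i, ∀ j ∈ Iᶜ, ∏ b ∈ range (μ i), (q * y j - q ^ b * x i) / (y j - q ^ b * x i)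
        = q ^ μ i * ((1 - x i / (q * y j)) / (1 - q ^ ((μ i : ℤ) - 1) * x i / y j)) := by
      intro i j hj
      rw [prod_range_telescope hq (hy0 i j hj) (hy' i j hj), zpow_sub_one₀ hq, zpow_natCast]
      have h5 := hy j
      have h6 := hIc i j hj
      have h7 : 1 - q ^ μ i * q⁻¹ * x i / y j = (q * y j - q ^ μ i * x i) / (q * y j) := by
        field_simp
      rw [h7]
      field_simp
    rw [Finset.prod_congr rfl fun i _ => Finset.prod_congr rfl (this i)]
    simp only [Finset.prod_mul_distrib, Finset.prod_const, ← pow_mul, Finset.prod_pow_eq_pow_sum,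
      ← Finset.sum_mul]
    rw [mul_comm (Iᶜ.card)]
  rw [redCoef_stringLengths, ← h3, Bcoef, vand_qShift_div_mul_prod_qPoch h, Finset.prod_mul_distrib, h1, h2]
  have hm : q ^ m = q ^ I.card * q ^ Iᶜ.card := by
    rw [← pow_add, Finset.card_add_card_compl, Fintype.card_fin]
  have hc : (∑ i, μ i + I.card).choose 2
      = (∑ i, μ i).choose 2 + I.card.choose 2 + I.card * ∑ i, μ i := by
    have h4 := two_mul_choose_two_add_self (∑ i, μ i + I.card)
    have h5 := two_mul_choose_two_add_self (∑ i, μ i)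
    have h6 := two_mul_choose_two_add_self I.card
    linarith
  have hpow : (t ^ ((1 : ℤ) - n) * q ^ m) ^ (∑ i, μ i) * (-t) ^ I.card
      * q ^ (I.card * (I.card - 1) / 2)
      * ((-1) ^ (∑ i, μ i) * q ^ (∑ i, μ i).choose 2) * t⁻¹ ^ (n * I.card)
      = (-t ^ ((1 : ℤ) - n)) ^ (∑ i, μ i + I.card) * q ^ (∑ i, μ i + I.card).choose 2
        * q ^ (Iᶜ.card * ∑ i, μ i) := by
    rw [hc, ← Nat.choose_two_right, hm]
    have ht' : (t ^ ((1 : ℤ) - n)) = t * t⁻¹ ^ n := by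
      rw [zpow_sub₀ ht, zpow_one, zpow_natCast, inv_pow, div_eq_mul_inv]
    rw [ht', neg_pow (t * _), neg_pow t]
    ring
  linear_combination
    ((∏ i, ∏ k, ∏ b ∈ range (μ i), (x k - t * (q ^ b * x i)) / (q ^ μ k * x k - q ^ b * x i))
      * (∏ j ∈ I, ∏ l ∈ Iᶜ, (q * y l - y j) / (y l - y j))
      * (∏ i, ∏ j ∈ I, (x i - t * y j) / (q ^ μ i * x i - y j))
      * ∏ i, ∏ j ∈ Iᶜ, (1 - x i / (q * y j)) / (1 - q ^ ((μ i : ℤ) - 1) * x i / y j)) * hpow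

theorem ne_mul_of_BcoefDen_ne_zero {r : ℕ}
    (h : ∀ (μ : Fin n → ℕ) (I : Finset (Fin m)), ∑ i, μ i + I.card ≤ r →
      BcoefDen n m q t μ I x y ≠ 0) (i : Fin n) (j : Fin m) :
    q * y j ≠ x i ∧ ∀ b < r, y j ≠ q ^ b * x i := by
  refine ⟨?_, fun b hb hj => ?_⟩
  · obtain ⟨-, -, -, -, -, -, -, -, hIc⟩ := BcoefDen_ne_zero (h 0 ∅ (by simp))
    simpa [sub_ne_zero] using hIc i j (by simp)
  · obtain ⟨-, -, -, -, -, -, -, -, hIc⟩ := BcoefDen_ne_zero (h (Pi.single i (b + 1)) ∅ (by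
      simpa [Finset.sum_pi_single'] using hb))
    refine hIc i j (by simp) ?_
    rw [Pi.single_eq_same, hj]
    ring

theorem stringRegular_of_BcoefDen_ne_zero {r s : ℕ} (hs : s ≤ r)
    (h : ∀ (μ : Fin n → ℕ) (I : Finset (Fin m)), ∑ i, μ i + I.card ≤ r →
      BcoefDen n m q t μ I x y ≠ 0) :
    StringRegular q s (Sum.elim x y) := by
  intro ν hν u b hb w hw
  have hb' : b < s := hb.trans_le (le_of_mem_stringIndex hν u)
  obtain ⟨μ, I, rfl⟩ : ∃ μ I, ν = stringLengths μ I := ⟨_, _, (stringLengths_eq_self hν).symm⟩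
  have hB := h μ I ((stringLengths_mem_stringIndex.1 hν).trans_le hs)
  obtain ⟨-, -, -, -, -, -, hyy, hI, -⟩ := BcoefDen_ne_zero hB
  have hxx := (prod_sub_ne_zero hB).2
  simp only [Finset.prod_ne_zero_iff] at hxx
  have hval : ∀ j, stringLengths μ I (.inr j) = if j ∈ I then 1 else 0 := fun _ => rfl
  rcases u with i | j <;> rcases w with k | l
  · exact sub_ne_zero.1 (hxx i (Finset.mem_univ _) k (Finset.mem_univ _) b (Finset.mem_range.2 hb))
  · have h0 : stringLengths μ I (.inr l) = 0 := by simpa using hw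
    rw [h0, pow_zero, one_mul]
    exact (ne_mul_of_BcoefDen_ne_zero h i l).2 b (hb'.trans_le hs)
  · have hj : j ∈ I := by
      by_contra hj
      rw [hval, if_neg hj] at hb
      omega
    rw [hval, if_pos hj, Nat.lt_one_iff] at hb
    rw [hb, pow_zero, one_mul]
    exact (sub_ne_zero.1 (hI k j hj)).symm
  · have h0 : stringLengths μ I (.inr l) = 0 := by simpa using hw
    have hl : l ∉ I := by
      intro hl
      rw [hval, if_pos hl] at h0
      omega
    have hj : j ∈ I := by
      by_contra hj
      rw [hval, if_neg hj] at hb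
      omega
    rw [h0]
    rw [hval, if_pos hj, Nat.lt_one_iff] at hb
    rw [hb, pow_zero, one_mul, one_mul]
    exact (sub_ne_zero.1 (hyy j hj l (Finset.mem_compl.2 hl))).symm

theorem Hop_eq_sum_stringSum {r : ℕ} (p : MvPolynomial (Fin n ⊕ Fin m) ℂ)
    (h : ∀ (μ : Fin n → ℕ) (I : Finset (Fin m)), ∑ i, μ i + I.card ≤ r →
      BcoefDen n m q t μ I x y ≠ 0) :
    Hop n m q t r (fun x' y' => evalXY p x' y') x y
      = ∑ k ∈ range (r + 1), cH n m q t k * ((-t ^ ((1 : ℤ) - n)) ^ (r - k)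
        * q ^ (r - k).choose 2) * stringSum q t p (r - k) t (Sum.elim x y) := by
  rw [Hop]
  refine Finset.sum_congr rfl fun k hk => ?_
  have hk := Finset.mem_range.1 hk
  rw [stringSum, sum_stringIndex _ (Nat.sub_le r k), Finset.mul_sum]
  refine Finset.sum_congr rfl fun μ _ => ?_
  rw [Finset.mul_sum]
  refine Finset.sum_congr rfl fun I _ => ?_
  by_cases hs : ∑ i, μ i + I.card = r - k
  · have hle : ∑ i, μ i + I.card ≤ r := hs.trans_le (Nat.sub_le r k)
    have hxy := ne_mul_of_BcoefDen_ne_zero h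
    have hμ : ∀ i, μ i ≤ r := fun i =>
      (Finset.single_le_sum (fun _ _ => Nat.zero_le _) (Finset.mem_univ i)).trans
        (by omega : ∑ i, μ i ≤ r)
    have hB := Bcoef_eq_redCoef (h μ I hle)
      (fun i j _ b hb => (hxy i j).2 b (hb.trans_le (hμ i))) fun i j _ => (hxy i j).1
    rw [hs] at hB
    rw [if_pos (by omega), if_pos hs, stringShift_stringLengths, evalXY]
    linear_combination cH n m q t k
      * MvPolynomial.eval (Sum.elim (qShift q μ x) (tShiftI t I y)) p * hB
  · rw [if_neg (by omega), if_neg hs, mul_zero]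

theorem memLambda_sum {ι : Type*} (S : Finset ι) (c : ι → ℂ)
    {Q : ι → MvPolynomial (Fin n ⊕ Fin m) ℂ} (hQ : ∀ k, memLambda n m q t (Q k)) :
    memLambda n m q t (∑ k ∈ S, MvPolynomial.C (c k) * Q k) := by
  refine ⟨fun σ τ x y => ?_, fun i j x y hxy => ?_⟩
  · simp only [evalXY, map_sum, map_mul, MvPolynomial.eval_C]
    exact Finset.sum_congr rfl fun k _ => congrArg _ ((hQ k).1 σ τ x y)
  · simp only [evalXY, map_sum, map_mul, MvPolynomial.eval_C]
    exact Finset.sum_congr rfl fun k _ => congrArg _ ((hQ k).2 i j x y hxy)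

end NoumiSanoCoefficients

/-- **The deformed Noumi–Sano operators preserve the algebra `Λ_{n,m;q,t}`**: if neither
`q` nor `t` is a root of unity and `p ∈ Λ_{n,m;q,t}`, then there is a polynomial
`P ∈ Λ_{n,m;q,t}` with `(ℋ^r_{n,m} p)(x,y) = P(x,y)` at every point where all the
coefficient functions `B_{μ,I}` occurring in the finite sum defining `ℋ^r_{n,m}` have
nonzero denominators. -/
theorem Hop_preserves_Lambda (n m r : ℕ) (q t : ℂ)
    (hq0 : q ≠ 0) (hq : ∀ k : ℕ, 1 ≤ k → q ^ k ≠ 1)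
    (ht0 : t ≠ 0) (ht : ∀ k : ℕ, 1 ≤ k → t ^ k ≠ 1)
    (p : MvPolynomial (Fin n ⊕ Fin m) ℂ) (hp : memLambda n m q t p) :
    ∃ P : MvPolynomial (Fin n ⊕ Fin m) ℂ, memLambda n m q t P ∧
      ∀ (x : Fin n → ℂ) (y : Fin m → ℂ),
        (∀ (μ : Fin n → ℕ) (I : Finset (Fin m)), (∑ i, μ i) + I.card ≤ r →
          BcoefDen n m q t μ I x y ≠ 0) →
        Hop n m q t r (fun x' y' => evalXY p x' y') x y = evalXY P x y := by
  choose Q hQ hQv using exists_memLambda_eval_eq_stringSum hq0 hq ht0 hp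
  refine ⟨_, memLambda_sum (range (r + 1)) (fun k => cH n m q t k * ((-t ^ ((1 : ℤ) - n)) ^ (r - k)
    * q ^ (r - k).choose 2)) (fun k => hQ (r - k)), fun x y h => ?_⟩
  rw [Hop_eq_sum_stringSum p h, evalXY]
  simp only [map_sum, map_mul, MvPolynomial.eval_C]
  exact Finset.sum_congr rfl fun k _ => by
    rw [hQv _ _ (stringRegular_of_BcoefDen_ne_zero (Nat.sub_le r k) h)]
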